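/- arXiv:2412.09235 — 2 statements merged into one kernel-verified Lean document; each statement's English description precedes it below -/
import Mathlib

section
/- Let X be a standard Borel space with a probability measure ρ, let μ and ν be probability measures on ℝ^d, let ε > 0, and let c : X × ℝ^d → ℝ be measurable with c(x,·) continuously differentiable for every x. Suppose there exist measurable functions φ^ν : X → ℝ, ψ^ν : ℝ^d → ℝ, φ^μ : X → ℝ, ψ^μ : ℝ^d → ℝ such that: (a) the measure π^ν on X × ℝ^d with density exp(−(c(x,y)+φ^ν(x)+ψ^ν(y))/ε) with respect to ρ⊗ν is a probability measure with marginals ρ and ν, and the measure π^μ with density exp(−(c(x,y)+φ^μ(x)+ψ^μ(y))/ε) with respect to ρ⊗μ is a probability measure with marginals ρ and μ; (b) for every y ∈ ℝ^d the measure π^ν(dx|y) := exp(−(c(x,y)+φ^ν(x)+ψ^ν(y))/ε) ρ(dx) is a probability measure, ψ^ν is differentiable, and ∇ψ^ν(y) = −∫_X ∇₂c(x,y) π^ν(dx|y) for every y; (c) there exists Λ > 0 such that for every x in the support of ρ the map y ↦ c(x,y) + ψ^ν(y) is Λ-semiconcave. Then KL(π^μ | π^ν) ≤ KL(μ | ν)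 + (Λ/(2ε)) · W₂²(μ, ν). -/
open MeasureTheory Real ENNReal Filter
open scoped RealInnerProductSpace

noncomputable section

open Classical in
/-- The Kullback--Leibler divergence `KL(μ|ν)`: `∫ log (dμ/dν) dμ` if `μ ≪ ν`, `+∞` otherwise. -/
def KL {α : Type*} [MeasurableSpace α] (μ ν : Measure α) : ℝ≥0∞ :=
  if μ ≪ ν then ENNReal.ofReal (∫ x, Real.log (μ.rnDeriv ν x).toReal ∂μ) else ⊤

/-- The (topological) support of a measure. -/
def msupport {α : Type*} [TopologicalSpace α] [MeasurableSpace α] (μ : Measure α) : Set α :=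
  {x | ∀ U : Set α, IsOpen U → x ∈ U → 0 < μ U}

/-- The generalized transport cost `W_ω(μ, ν)`: the infimum of `∫ ω(z, y) dπ(z, y)` over
couplings `π` of `(μ, ν)`. -/
def Wcost {α : Type*} [MeasurableSpace α] (ω : α → α → ℝ) (μ ν : Measure α) : ℝ≥0∞ :=
  ⨅ (P : Measure (α × α)) (_ : P.map Prod.fst = μ ∧ P.map Prod.snd = ν),
    ∫⁻ p, ENNReal.ofReal (ω p.1 p.2) ∂P

/-- The squared Wasserstein distance of order two. -/
def W2sq {α : Type*} [MeasurableSpace α] [NormedAddCommGroup α] (μ ν : Measure α) : ℝ≥0∞ :=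
  Wcost (fun y z => ‖y - z‖ ^ 2) μ ν

/-- Talagrand's transport inequality `TI(τ)` for `ν`. -/
def TI {α : Type*} [MeasurableSpace α] [NormedAddCommGroup α] (τ : ℝ) (ν : Measure α) : Prop :=
  ∀ μ : Measure α, IsProbabilityMeasure μ → W2sq μ ν ≤ ENNReal.ofReal (2 * τ) * KL μ ν

/-- The generalized transport inequality `TI_ω(τ)` for `ν`. -/
def TIcost {α : Type*} [MeasurableSpace α] (ω : α → α → ℝ) (τ : ℝ) (ν : Measure α) : Prop :=
  ∀ μ : Measure α, IsProbabilityMeasure μ → Wcost ω μ ν ≤ ENNReal.ofReal (2 * τ) * KL μ ν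

/-- `Λ`-semiconcavity of a (differentiable) function on an inner product space. -/
def Semiconcave {E : Type*} [NormedAddCommGroup E] [InnerProductSpace ℝ E] [CompleteSpace E]
    (Λ : ℝ) (f : E → ℝ) : Prop :=
  ∀ y z : E, f z - f y ≤ ⟪gradient f y, z - y⟫ + Λ / 2 * ‖z - y‖ ^ 2

/-- `(Λ, ω)`-semiconcavity of a (differentiable) function on an inner product space. -/
def SemiconcaveW {E : Type*} [NormedAddCommGroup E] [InnerProductSpace ℝ E] [CompleteSpace E]
    (Λ : ℝ) (ω : E → E → ℝ) (f : E → ℝ) : Prop :=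
  ∀ y z : E, f z - f y ≤ ⟪gradient f y, z - y⟫ + Λ / 2 * ω z y

/-- The plan with density `exp(-(c(x,y) + f(x) + g(y))/ε)` with respect to `ρ ⊗ ν`. -/
def plan {X Y : Type*} [MeasurableSpace X] [MeasurableSpace Y]
    (ρ : Measure X) (ν : Measure Y) [SFinite ν] (ε : ℝ) (c : X → Y → ℝ)
    (f : X → ℝ) (g : Y → ℝ) : Measure (X × Y) :=
  (ρ.prod ν).withDensity fun p => ENNReal.ofReal (Real.exp (-(c p.1 p.2 + f p.1 + g p.2) / ε))

/-- The conditional plan given the second coordinate `y`: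
`π(dx|y) = exp(-(c(x,y) + f(x) + g(y))/ε) ρ(dx)`. -/
def condSnd {X Y : Type*} [MeasurableSpace X]
    (ρ : Measure X) (ε : ℝ) (c : X → Y → ℝ) (f : X → ℝ) (g : Y → ℝ) (y : Y) : Measure X :=
  ρ.withDensity fun x => ENNReal.ofReal (Real.exp (-(c x y + f x + g y) / ε))

/-- The conditional plan given the first coordinate `x`:
`π(dy|x) = exp(-(c(x,y) + f(x) + g(y))/ε) ν(dy)`. -/
def condFst {X Y : Type*} [MeasurableSpace Y]
    (ν : Measure Y) (ε : ℝ) (c : X → Y → ℝ) (f : X → ℝ) (g : Y → ℝ) (x : X) : Measure Y :=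
  ν.withDensity fun y => ENNReal.ofReal (Real.exp (-(c x y + f x + g y) / ε))

/-- The logarithmic Sobolev inequality `LSI(C)` for `ρ`. -/
def LSI {F : Type*} [NormedAddCommGroup F] [InnerProductSpace ℝ F] [CompleteSpace F]
    [MeasurableSpace F] (C : ℝ) (ρ : Measure F) : Prop :=
  ∀ g : F → ℝ, Differentiable ℝ g → (∀ x, 0 < g x) →
    IsProbabilityMeasure (ρ.withDensity fun x => ENNReal.ofReal (g x)) →
    KL (ρ.withDensity fun x => ENNReal.ofReal (g x)) ρ ≤
      ENNReal.ofReal (C / 2 * ∫ x, ‖gradient (fun x' => Real.log (g x')) x‖ ^ 2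
        ∂(ρ.withDensity fun x => ENNReal.ofReal (g x)))

namespace KLStability

/-- Truncation of a real number to `[-n, n]`. -/
def clip (n : ℕ) (a : ℝ) : ℝ := max (-(n : ℝ)) (min a n)

lemma measurable_clip (n : ℕ) : Measurable (clip n) := by
  unfold clip; fun_prop

lemma abs_clip_le (n : ℕ) (a : ℝ) : |clip n a| ≤ n := by
  have hn : (0 : ℝ) ≤ n := n.cast_nonneg
  exact abs_le.2 ⟨le_max_left _ _, max_le (by linarith) (min_le_right _ _)⟩

lemma abs_clip_add_clip_le (n : ℕ) (a b : ℝ) : |clip n a + clip n b| ≤ |a + b| := by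
  have hn : (0 : ℝ) ≤ n := n.cast_nonneg
  unfold clip
  grind

lemma clip_add_clip_le (n : ℕ) (a b : ℝ) : clip n a + clip n b ≤ max (a + b) 0 := by
  have hn : (0 : ℝ) ≤ n := n.cast_nonneg
  unfold clip
  grind

lemma tendsto_clip (a : ℝ) : Tendsto (fun n : ℕ => clip n a) atTop (nhds a) := by
  refine tendsto_const_nhds.congr' ?_
  filter_upwards [eventually_ge_atTop ⌈|a|⌉₊] with n hn
  have h : |a| ≤ n := (Nat.le_ceil _).trans (by exact_mod_cast hn)
  unfold clip
  rw [min_eq_left (abs_le.1 h).2, max_eq_right (abs_le.1 h).1]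

/-- An integrable function of the form `A ⊕ B` has the same truncated integrals under any two
measures with the same marginals, so it can be compared with an integrable upper bound living
over another coupling, without integrability of `A` and `B` separately. -/
lemma integral_add_le_of_marginals_eq {X Y Ω : Type*} [MeasurableSpace X] [MeasurableSpace Y]
    [MeasurableSpace Ω] {P : Measure (X × Y)} [IsFiniteMeasure P] {Q : Measure Ω}
    [IsFiniteMeasure Q] {u : Ω → X} {v : Ω → Y} (hu : Measurable u) (hv : Measurable v)
    (hQu : Q.map u = P.map Prod.fst) (hQv : Q.map v = P.map Prod.snd)
    {A : X → ℝ} {B : Y → ℝ} (hA : Measurable A) (hB : Measurable B)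
    (hAB : Integrable (fun p : X × Y => A p.1 + B p.2) P)
    {U : Ω → ℝ} (hU : Integrable U Q) (hle : ∀ᵐ w ∂Q, A (u w) + B (v w) ≤ U w) :
    ∫ p, (A p.1 + B p.2) ∂P ≤ ∫ w, U w ∂Q := by
  have hAn (n : ℕ) : Measurable fun x => clip n (A x) := (measurable_clip n).comp hA
  have hBn (n : ℕ) : Measurable fun y => clip n (B y) := (measurable_clip n).comp hB
  have intP (n : ℕ) : Integrable (fun p : X × Y => clip n (A p.1)) P :=
    Integrable.of_bound ((hAn n).comp measurable_fst).aestronglyMeasurable n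
      (ae_of_all _ fun _ => abs_clip_le n _)
  have intP' (n : ℕ) : Integrable (fun p : X × Y => clip n (B p.2)) P :=
    Integrable.of_bound ((hBn n).comp measurable_snd).aestronglyMeasurable n
      (ae_of_all _ fun _ => abs_clip_le n _)
  have intQ (n : ℕ) : Integrable (fun w => clip n (A (u w))) Q :=
    Integrable.of_bound ((hAn n).comp hu).aestronglyMeasurable n
      (ae_of_all _ fun _ => abs_clip_le n _)
  have intQ' (n : ℕ) : Integrable (fun w => clip n (B (v w))) Q :=
    Integrable.of_bound ((hBn n).comp hv).aestronglyMeasurable n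
      (ae_of_all _ fun _ => abs_clip_le n _)
  have heq (n : ℕ) : ∫ p, (clip n (A p.1) + clip n (B p.2)) ∂P
      = ∫ w, (clip n (A (u w)) + clip n (B (v w))) ∂Q := by
    rw [integral_add (intP n) (intP' n), integral_add (intQ n) (intQ' n)]
    congr 1
    · rw [← integral_map (φ := Prod.fst) (f := fun x => clip n (A x)) (by fun_prop)
        (hAn n).aestronglyMeasurable, ← hQu,
        integral_map hu.aemeasurable (hAn n).aestronglyMeasurable]
    · rw [← integral_map (φ := Prod.snd) (f := fun y => clip n (B y)) (by fun_prop)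
        (hBn n).aestronglyMeasurable, ← hQv,
        integral_map hv.aemeasurable (hBn n).aestronglyMeasurable]
  have lim1 : Tendsto (fun n : ℕ => ∫ p, (clip n (A p.1) + clip n (B p.2)) ∂P) atTop
      (nhds (∫ p, (A p.1 + B p.2) ∂P)) :=
    tendsto_integral_of_dominated_convergence (fun p => |A p.1 + B p.2|)
      (fun n => ((intP n).add (intP' n)).aestronglyMeasurable) hAB.abs
      (fun n => ae_of_all _ fun p => abs_clip_add_clip_le n _ _)
      (ae_of_all _ fun p => (tendsto_clip _).add (tendsto_clip _))
  have meas (n : ℕ) : AEStronglyMeasurable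
      (fun w => max (U w) (clip n (A (u w)) + clip n (B (v w)))) Q :=
    hU.aestronglyMeasurable.sup ((intQ n).add (intQ' n)).aestronglyMeasurable
  have bound (n : ℕ) : ∀ᵐ w ∂Q,
      ‖max (U w) (clip n (A (u w)) + clip n (B (v w)))‖ ≤ |U w| := by
    filter_upwards [hle] with w hw
    have := clip_add_clip_le n (A (u w)) (B (v w))
    rw [Real.norm_eq_abs]
    grind
  have lim2 : Tendsto (fun n : ℕ => ∫ w, max (U w) (clip n (A (u w)) + clip n (B (v w))) ∂Q) atTop
      (nhds (∫ w, U w ∂Q)) := by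
    refine tendsto_integral_of_dominated_convergence (fun w => |U w|) meas hU.abs bound ?_
    filter_upwards [hle] with w hw
    have := tendsto_const_nhds (x := U w) (f := (atTop : Filter ℕ)) |>.max
      ((tendsto_clip (A (u w))).add (tendsto_clip (B (v w))))
    rwa [max_eq_left hw] at this
  refine le_of_tendsto_of_tendsto' lim1 lim2 fun n => ?_
  rw [heq n]
  exact integral_mono ((intQ n).add (intQ' n)) (hU.abs.mono' (meas n) (bound n))
    fun w => le_max_right _ _

/-- If `f + g` is integrable and `f`, `g` have integrable negative exponentials, then `f` is
integrable. -/
lemma integrable_left_of_add_of_exp_neg {α : Type*} [MeasurableSpace α] {m : Measure α}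
    {f g : α → ℝ} (hf : AEStronglyMeasurable f m) (hfg : Integrable (fun a => f a + g a) m)
    (hfe : Integrable (fun a => Real.exp (-f a)) m)
    (hge : Integrable (fun a => Real.exp (-g a)) m) : Integrable f m := by
  refine ((hfg.abs.add hfe).add hge).mono' hf (ae_of_all _ fun a => ?_)
  have h1 := Real.add_one_le_exp (-f a)
  have h2 := Real.add_one_le_exp (-g a)
  have h3 := Real.exp_pos (-f a)
  have h4 := Real.exp_pos (-g a)
  have h5 := neg_abs_le (f a + g a)
  have h6 := le_abs_self (f a + g a)
  simp only [Pi.add_apply, Real.norm_eq_abs]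
  exact abs_le'.2 ⟨by linarith, by linarith [abs_nonneg (f a + g a)]⟩

lemma ae_mem_msupport {X : Type*} [TopologicalSpace X] [HereditarilyLindelofSpace X]
    [MeasurableSpace X] (ρ : Measure X) : ∀ᵐ x ∂ρ, x ∈ msupport ρ := by
  filter_upwards [Measure.support_mem_ae (μ := ρ)] with x hx U hU hxU
  exact (Measure.mem_support_iff_forall x).1 hx U (hU.mem_nhds hxU)

lemma integrable_of_lintegral_ofReal_ne_top {α : Type*} [MeasurableSpace α] {m : Measure α}
    {f : α → ℝ} (hf : AEStronglyMeasurable f m) (h0 : ∀ a, 0 ≤ f a)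
    (h : ∫⁻ a, ENNReal.ofReal (f a) ∂m ≠ ⊤) : Integrable f m :=
  ⟨hf, (hasFiniteIntegral_iff_ofReal (ae_of_all _ h0)).2 h.lt_top⟩

section Density

variable {X Y : Type*} [MeasurableSpace X] {ρ : Measure X} {ε : ℝ} {c : X → Y → ℝ} {f : X → ℝ}
  {g : Y → ℝ}

lemma measurable_density [MeasurableSpace Y] (hc : Measurable (Function.uncurry c))
    (hf : Measurable f) (hg : Measurable g) :
    Measurable fun p : X × Y => ENNReal.ofReal (Real.exp (-(c p.1 p.2 + f p.1 + g p.2) / ε)) := by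
  have : Measurable fun p : X × Y => c p.1 p.2 := hc
  fun_prop

lemma lintegral_density_eq_one (hprob : ∀ y, IsProbabilityMeasure (condSnd ρ ε c f g y)) (y : Y) :
    ∫⁻ x, ENNReal.ofReal (Real.exp (-(c x y + f x + g y) / ε)) ∂ρ = 1 := by
  have := (hprob y).measure_univ
  rwa [condSnd, withDensity_apply _ MeasurableSet.univ, Measure.restrict_univ] at this

end Density

section Gradient

variable {X : Type*} [MeasurableSpace X]
  {E : Type*} [NormedAddCommGroup E] [InnerProductSpace ℝ E] [FiniteDimensional ℝ E]
  [MeasurableSpace E] [BorelSpace E]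

lemma measurable_inner_gradient {Ω : Type*} [MeasurableSpace Ω] {h : X → E → ℝ}
    (hm : Measurable (Function.uncurry h)) (hd : ∀ x, Differentiable ℝ (h x))
    {a : Ω → X} {b w : Ω → E} (ha : Measurable a) (hb : Measurable b) (hw : Measurable w) :
    Measurable fun ω => ⟪gradient (h (a ω)) (b ω), w ω⟫ := by
  refine measurable_of_tendsto_metrizable
    (f := fun (n : ℕ) ω => (n : ℝ) • (h (a ω) (b ω + (n : ℝ)⁻¹ • w ω) - h (a ω) (b ω)))
    (fun n => ?_) (tendsto_pi_nhds.2 fun ω => ?_)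
  · have h1 : Measurable fun ω => h (a ω) (b ω + (n : ℝ)⁻¹ • w ω) :=
      hm.comp (ha.prodMk (hb.add (hw.const_smul (n : ℝ)⁻¹)))
    have h2 : Measurable fun ω => h (a ω) (b ω) := hm.comp (ha.prodMk hb)
    exact (h1.sub h2).const_smul (n : ℝ)
  · rw [inner_gradient_left]
    exact (hd (a ω) (b ω)).hasFDerivAt.lim (w ω)
      (tendsto_norm_atTop_atTop.comp tendsto_natCast_atTop_atTop)

variable {ρ : Measure X} {ε Λ : ℝ} {c : X → E → ℝ} {f : X → ℝ} {g : E → ℝ}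

/-- Semiconcavity makes the gradient sub-Gaussian under the conditional plans. -/
lemma lintegral_exp_inner_gradient_le (hε : 0 < ε)
    (hc : Measurable (Function.uncurry c)) (hf : Measurable f) (hg : Measurable g)
    (hcd : ∀ x, Differentiable ℝ (c x)) (hgd : Differentiable ℝ g)
    (hprob : ∀ y, IsProbabilityMeasure (condSnd ρ ε c f g y))
    (hsc : ∀ᵐ x ∂ρ, Semiconcave Λ (fun y => c x y + g y)) (y v : E) :
    ∫⁻ x, ENNReal.ofReal (Real.exp (-⟪gradient (fun y => c x y + g y) y, v⟫ / ε))
        ∂(condSnd ρ ε c f g y) ≤ ENNReal.ofReal (Real.exp (Λ * ‖v‖ ^ 2 / (2 * ε))) := by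
  have hm : Measurable (Function.uncurry fun x y => c x y + g y) := by
    have : Measurable fun p : X × E => c p.1 p.2 := hc
    exact this.add (hg.comp measurable_snd)
  have hG := measurable_inner_gradient hm (fun x => (hcd x).add hgd) (measurable_id (α := X))
    (measurable_const (a := y)) (measurable_const (a := v))
  have hk : Measurable fun x => ENNReal.ofReal (Real.exp (-(c x y + f x + g y) / ε)) :=
    (measurable_density hc hf hg).comp (measurable_id.prodMk measurable_const)
  rw [condSnd, lintegral_withDensity_eq_lintegral_mul _ hk (by fun_prop)]
  calc _ ≤ ∫⁻ x, ENNReal.ofReal (Real.exp (Λ * ‖v‖ ^ 2 / (2 * ε))) *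
        ENNReal.ofReal (Real.exp (-(c x (y + v) + f x + g (y + v)) / ε)) ∂ρ := by
        refine lintegral_mono_ae ?_
        filter_upwards [hsc] with x hx
        have := hx y (y + v)
        rw [Pi.mul_apply, ← ENNReal.ofReal_mul (Real.exp_pos _).le,
          ← ENNReal.ofReal_mul (Real.exp_pos _).le, ← Real.exp_add, ← Real.exp_add]
        refine ENNReal.ofReal_le_ofReal (Real.exp_le_exp.2 ?_)
        simp only [add_sub_cancel_left] at this
        have e : Λ * ‖v‖ ^ 2 / (2 * ε) = (Λ / 2 * ‖v‖ ^ 2) / ε := by field_simp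
        rw [e, ← add_div, ← add_div, div_le_div_iff_of_pos_right hε]
        linarith
    _ = _ := by
        rw [lintegral_const_mul', lintegral_density_eq_one hprob, mul_one]
        exact ENNReal.ofReal_ne_top

lemma lintegral_enorm_inner_gradient_le (hε : 0 < ε)
    (hc : Measurable (Function.uncurry c)) (hf : Measurable f) (hg : Measurable g)
    (hcd : ∀ x, Differentiable ℝ (c x)) (hgd : Differentiable ℝ g)
    (hprob : ∀ y, IsProbabilityMeasure (condSnd ρ ε c f g y))
    (hsc : ∀ᵐ x ∂ρ, Semiconcave Λ (fun y => c x y + g y)) (y w : E) :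
    ∫⁻ x, ‖⟪gradient (fun y => c x y + g y) y, w⟫‖ₑ ∂(condSnd ρ ε c f g y)
      ≤ ENNReal.ofReal (2 * ε * Real.exp (Λ / (2 * ε))) * ENNReal.ofReal ‖w‖ := by
  rcases eq_or_ne w 0 with rfl | hw
  · simp
  have hw' : 0 < ‖w‖ := norm_pos_iff.2 hw
  have hm : Measurable (Function.uncurry fun x y => c x y + g y) := by
    have : Measurable fun p : X × E => c p.1 p.2 := hc
    exact this.add (hg.comp measurable_snd)
  have hG (v : E) := measurable_inner_gradient hm (fun x => (hcd x).add hgd)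
    (measurable_id (α := X)) (measurable_const (a := y)) (measurable_const (a := v))
  set v : E := ‖w‖⁻¹ • w with hv
  have hv1 : ‖v‖ = 1 := by rw [hv, norm_smul, norm_inv, norm_norm, inv_mul_cancel₀ hw'.ne']
  have hwv : w = ‖w‖ • v := by rw [hv, smul_smul, mul_inv_cancel₀ hw'.ne', one_smul]
  have b1 := lintegral_exp_inner_gradient_le hε hc hf hg hcd hgd hprob hsc y v
  have b2 := lintegral_exp_inner_gradient_le hε hc hf hg hcd hgd hprob hsc y (-v)
  rw [norm_neg] at b2
  rw [hv1, one_pow, mul_one] at b1 b2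
  calc _ ≤ ∫⁻ x, ENNReal.ofReal (ε * ‖w‖) *
        (ENNReal.ofReal (Real.exp (-⟪gradient (fun y => c x y + g y) y, v⟫ / ε)) +
        ENNReal.ofReal (Real.exp (-⟪gradient (fun y => c x y + g y) y, -v⟫ / ε)))
          ∂(condSnd ρ ε c f g y) := by
        refine lintegral_mono fun x => ?_
        rw [← ENNReal.ofReal_add (Real.exp_pos _).le (Real.exp_pos _).le,
          ← ENNReal.ofReal_mul (by positivity), ← ofReal_norm]
        refine ENNReal.ofReal_le_ofReal ?_
        set t := ⟪gradient (fun y => c x y + g y) y, v⟫ / ε with ht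
        have e : ⟪gradient (fun y => c x y + g y) y, w⟫ = ε * ‖w‖ * t := by
          conv_lhs => rw [hwv]
          rw [real_inner_smul_right, ht]; field_simp
        rw [e, inner_neg_right, neg_neg, neg_div, ← ht, norm_mul, Real.norm_eq_abs,
          abs_of_pos (by positivity), Real.norm_eq_abs]
        gcongr
        have h1 := Real.add_one_le_exp t
        have h2 := Real.add_one_le_exp (-t)
        have h3 := Real.exp_pos t
        have h4 := Real.exp_pos (-t)
        exact abs_le'.2 ⟨by linarith, by linarith⟩
    _ = ENNReal.ofReal (ε * ‖w‖) *
        (∫⁻ x, ENNReal.ofReal (Real.exp (-⟪gradient (fun y => c x y + g y) y, v⟫ / ε))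
          ∂(condSnd ρ ε c f g y) +
        ∫⁻ x, ENNReal.ofReal (Real.exp (-⟪gradient (fun y => c x y + g y) y, -v⟫ / ε))
          ∂(condSnd ρ ε c f g y)) := by
        have := hG v
        rw [lintegral_const_mul' _ _ ENNReal.ofReal_ne_top, lintegral_add_left (by fun_prop)]
    _ ≤ ENNReal.ofReal (ε * ‖w‖) * (ENNReal.ofReal (Real.exp (Λ / (2 * ε))) +
          ENNReal.ofReal (Real.exp (Λ / (2 * ε)))) := by gcongr
    _ = _ := by
        rw [← ENNReal.ofReal_add (Real.exp_pos _).le (Real.exp_pos _).le,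
          ← ENNReal.ofReal_mul (by positivity), ← ENNReal.ofReal_mul (by positivity)]
        congr 1; ring

lemma integral_inner_gradient_eq_zero (hε : 0 < ε)
    (hc : Measurable (Function.uncurry c)) (hf : Measurable f) (hg : Measurable g)
    (hcd : ∀ x, Differentiable ℝ (c x)) (hgd : Differentiable ℝ g)
    (hprob : ∀ y, IsProbabilityMeasure (condSnd ρ ε c f g y))
    (hgrad : ∀ y, gradient g y = -∫ x, gradient (c x) y ∂(condSnd ρ ε c f g y))
    (hsc : ∀ᵐ x ∂ρ, Semiconcave Λ (fun y => c x y + g y)) (y w : E) :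
    ∫ x, ⟪gradient (fun y => c x y + g y) y, w⟫ ∂(condSnd ρ ε c f g y) = 0 := by
  have hm : Measurable (Function.uncurry fun x y => c x y + g y) := by
    have : Measurable fun p : X × E => c p.1 p.2 := hc
    exact this.add (hg.comp measurable_snd)
  have hadd (x : X) : gradient (fun y => c x y + g y) y = gradient (c x) y + gradient g y := by
    simp only [gradient]
    rw [fderiv_fun_add (hcd x y) (hgd y), map_add]
  have hsum : Integrable (fun x => gradient (fun y => c x y + g y) y) (condSnd ρ ε c f g y) := by
    have : (fun x => gradient (fun y => c x y + g y) y) = fun x =>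
        ∑ i, ⟪gradient (fun y => c x y + g y) y, stdOrthonormalBasis ℝ E i⟫ •
          stdOrthonormalBasis ℝ E i := by
      funext x
      conv_lhs => rw [← (stdOrthonormalBasis ℝ E).sum_repr' (gradient (fun y => c x y + g y) y)]
      simp only [real_inner_comm]
    rw [this]
    refine integrable_finsetSum _ fun i _ => Integrable.smul_const ⟨?_, ?_⟩ _
    · exact (measurable_inner_gradient hm (fun x => (hcd x).add hgd) measurable_id
        measurable_const measurable_const).aestronglyMeasurable
    · exact (lintegral_enorm_inner_gradient_le hε hc hf hg hcd hgd hprob hsc y _).trans_lt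
        (ENNReal.mul_lt_top ENNReal.ofReal_lt_top ENNReal.ofReal_lt_top)
  have := hprob y
  have hcint : Integrable (fun x => gradient (c x) y) (condSnd ρ ε c f g y) := by
    refine (hsum.sub (integrable_const (gradient g y))).congr (ae_of_all _ fun x => ?_)
    simp [hadd]
  have hzero : ∫ x, gradient (fun y => c x y + g y) y ∂(condSnd ρ ε c f g y) = 0 := by
    simp_rw [hadd]
    rw [integral_add hcint (integrable_const _), integral_const, probReal_univ, one_smul,
      hgrad y, add_neg_cancel]
  simp_rw [real_inner_comm w]
  rw [integral_inner hsum, hzero, inner_zero_right]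

end Gradient

section Gluing

variable {X Y : Type*} [MeasurableSpace X] [MeasurableSpace Y]

/-- The law of `(x, z, y)` when `(z, y)` has law `P` and `x` is drawn from the conditional plan
given `y`. -/
def gluing (ρ : Measure X) (P : Measure (Y × Y)) [SFinite P] (ε : ℝ) (c : X → Y → ℝ)
    (f : X → ℝ) (g : Y → ℝ) : Measure (X × Y × Y) :=
  (ρ.prod P).withDensity fun q =>
    ENNReal.ofReal (Real.exp (-(c q.1 q.2.2 + f q.1 + g q.2.2) / ε))

variable {ρ : Measure X} [IsProbabilityMeasure ρ] {P : Measure (Y × Y)} [SFinite P] {ε : ℝ}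
  {c : X → Y → ℝ} {f : X → ℝ} {g : Y → ℝ}

lemma measurable_gluing_density (hc : Measurable (Function.uncurry c)) (hf : Measurable f)
    (hg : Measurable g) : Measurable fun q : X × Y × Y =>
      ENNReal.ofReal (Real.exp (-(c q.1 q.2.2 + f q.1 + g q.2.2) / ε)) :=
  (measurable_density hc hf hg).comp (measurable_fst.prodMk (measurable_snd.comp measurable_snd))

lemma lintegral_gluing (hc : Measurable (Function.uncurry c)) (hf : Measurable f)
    (hg : Measurable g) {F : X × Y × Y → ℝ≥0∞} (hF : Measurable F) :
    ∫⁻ q, F q ∂(gluing ρ P ε c f g) =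
      ∫⁻ p, ∫⁻ x, F (x, p) ∂(condSnd ρ ε c f g p.2) ∂P := by
  have hk := measurable_gluing_density (ε := ε) hc hf hg
  rw [gluing, lintegral_withDensity_eq_lintegral_mul _ hk hF, lintegral_prod_symm' _ (hk.mul hF)]
  refine lintegral_congr fun p => ?_
  have hkp : Measurable fun x => ENNReal.ofReal (Real.exp (-(c x p.2 + f x + g p.2) / ε)) :=
    hk.comp (measurable_id.prodMk measurable_const)
  have hFp : Measurable fun x => F (x, p) := hF.comp (measurable_id.prodMk measurable_const)
  rw [condSnd, lintegral_withDensity_eq_lintegral_mul _ hkp hFp]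
  rfl

lemma integral_gluing_eq_zero (hc : Measurable (Function.uncurry c)) (hf : Measurable f)
    (hg : Measurable g) {F : X × Y × Y → ℝ} (hF : Integrable F (gluing ρ P ε c f g))
    (h0 : ∀ p : Y × Y, ∫ x, F (x, p) ∂(condSnd ρ ε c f g p.2) = 0) :
    ∫ q, F q ∂(gluing ρ P ε c f g) = 0 := by
  have hk := measurable_gluing_density (ε := ε) hc hf hg
  have hfin : ∀ᵐ q ∂(ρ.prod P),
      ENNReal.ofReal (Real.exp (-(c q.1 q.2.2 + f q.1 + g q.2.2) / ε)) < ⊤ :=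
    ae_of_all _ fun _ => ENNReal.ofReal_lt_top
  rw [gluing, integrable_withDensity_iff_integrable_smul' hk hfin] at hF
  rw [gluing, integral_withDensity_eq_integral_toReal_smul hk hfin, integral_prod_symm _ hF]
  refine integral_eq_zero_of_ae (ae_of_all _ fun p => ?_)
  have hkp : Measurable fun x => ENNReal.ofReal (Real.exp (-(c x p.2 + f x + g p.2) / ε)) :=
    hk.comp (measurable_id.prodMk measurable_const)
  have := h0 p
  rwa [condSnd, integral_withDensity_eq_integral_toReal_smul hkp
    (ae_of_all _ fun _ => ENNReal.ofReal_lt_top)] at this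

lemma gluing_map_snd (hc : Measurable (Function.uncurry c)) (hf : Measurable f)
    (hg : Measurable g) (hprob : ∀ y, IsProbabilityMeasure (condSnd ρ ε c f g y)) :
    (gluing ρ P ε c f g).map Prod.snd = P := by
  ext s hs
  rw [Measure.map_apply measurable_snd hs, ← lintegral_indicator_one (measurable_snd hs),
    lintegral_gluing hc hf hg (measurable_one.indicator (measurable_snd hs)),
    ← lintegral_indicator_one hs]
  refine lintegral_congr fun p => ?_
  change ∫⁻ _, s.indicator 1 p ∂_ = _
  rw [lintegral_const, (hprob p.2).measure_univ, mul_one]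

lemma map_prod_left {Z W : Type*} [MeasurableSpace Z] [MeasurableSpace W]
    (Q : Measure Z) [SFinite Q] {t : Z → W} (ht : Measurable t) :
    (ρ.prod Q).map (fun q => (q.1, t q.2)) = ρ.prod (Q.map t) := by
  have := Measure.map_prod_map ρ Q measurable_id ht
  rw [Measure.map_id] at this
  rw [this]
  rfl

lemma gluing_map_plan (hc : Measurable (Function.uncurry c)) (hf : Measurable f)
    (hg : Measurable g) {ν : Measure Y} [SFinite ν] (hP : P.map Prod.snd = ν) :
    (gluing ρ P ε c f g).map (fun q => (q.1, q.2.2)) = plan ρ ν ε c f g := by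
  subst hP
  have ht : Measurable fun q : X × Y × Y => (q.1, q.2.2) := by fun_prop
  ext s hs
  rw [Measure.map_apply ht hs, gluing, withDensity_apply _ (ht hs), plan, withDensity_apply _ hs,
    ← map_prod_left P measurable_snd,
    setLIntegral_map hs (measurable_density hc hf hg) ht]

/-- The ratio of the two Gibbs densities integrates to the mass of the second plan. -/
lemma lintegral_exp_gluing (hc : Measurable (Function.uncurry c)) (hf : Measurable f)
    (hg : Measurable g) {f' : X → ℝ} {g' : Y → ℝ} (hf' : Measurable f') (hg' : Measurable g')
    {μ : Measure Y} [SFinite μ] (hP : P.map Prod.fst = μ) :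
    ∫⁻ q, ENNReal.ofReal (Real.exp ((c q.1 q.2.2 + f q.1 + g q.2.2) / ε
        - (c q.1 q.2.1 + f' q.1 + g' q.2.1) / ε)) ∂(gluing ρ P ε c f g)
      = plan ρ μ ε c f' g' Set.univ := by
  subst hP
  have hk := measurable_gluing_density (ε := ε) hc hf hg
  have h1 : Measurable fun q : X × Y × Y => c q.1 q.2.2 :=
    hc.comp (measurable_fst.prodMk (measurable_snd.comp measurable_snd))
  have h2 : Measurable fun q : X × Y × Y => c q.1 q.2.1 :=
    hc.comp (measurable_fst.prodMk (measurable_fst.comp measurable_snd))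
  rw [gluing, lintegral_withDensity_eq_lintegral_mul _ hk (by fun_prop), plan,
    withDensity_apply _ MeasurableSet.univ, Measure.restrict_univ,
    ← map_prod_left P measurable_fst, lintegral_map (measurable_density hc hf' hg') (by fun_prop)]
  refine lintegral_congr fun q => ?_
  rw [Pi.mul_apply, ← ENNReal.ofReal_mul (Real.exp_pos _).le, ← Real.exp_add]
  congr 2
  ring

end Gluing

section Potentials

variable {X : Type*} [MeasurableSpace X]
  {E : Type*} [NormedAddCommGroup E] [InnerProductSpace ℝ E] [FiniteDimensional ℝ E]
  [MeasurableSpace E] [BorelSpace E]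

lemma integrable_inner_gradient_gluing {ρ : Measure X} [IsProbabilityMeasure ρ] {ε Λ : ℝ}
    (hε : 0 < ε) {c : X → E → ℝ} {f : X → ℝ} {g : E → ℝ}
    (hc : Measurable (Function.uncurry c)) (hf : Measurable f) (hg : Measurable g)
    (hcd : ∀ x, Differentiable ℝ (c x)) (hgd : Differentiable ℝ g)
    (hprob : ∀ y, IsProbabilityMeasure (condSnd ρ ε c f g y))
    (hsc : ∀ᵐ x ∂ρ, Semiconcave Λ (fun y => c x y + g y))
    {P : Measure (E × E)} [IsFiniteMeasure P]
    (hsq : Integrable (fun p : E × E => ‖p.1 - p.2‖ ^ 2) P) :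
    Integrable (fun q : X × E × E =>
      ⟪gradient (fun y => c q.1 y + g y) q.2.2, q.2.1 - q.2.2⟫) (gluing ρ P ε c f g) := by
  have hm : Measurable (Function.uncurry fun x y => c x y + g y) := by
    have : Measurable fun p : X × E => c p.1 p.2 := hc
    exact this.add (hg.comp measurable_snd)
  have hGm : Measurable (fun q : X × E × E =>
      ⟪gradient (fun y => c q.1 y + g y) q.2.2, q.2.1 - q.2.2⟫) :=
    measurable_inner_gradient hm (fun x => (hcd x).add hgd)
      measurable_fst (measurable_snd.comp measurable_snd) (by fun_prop)
  have hnorm : Integrable (fun p : E × E => ‖p.1 - p.2‖) P := by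
    refine ((integrable_const (1 : ℝ)).add hsq).mono' (by fun_prop) (ae_of_all _ fun p => ?_)
    simp only [Pi.add_apply, norm_norm]
    nlinarith [sq_nonneg (‖p.1 - p.2‖ - 1 / 2)]
  refine ⟨hGm.aestronglyMeasurable, ?_⟩
  rw [HasFiniteIntegral, lintegral_gluing hc hf hg hGm.enorm]
  calc _ ≤ ∫⁻ p : E × E, ENNReal.ofReal (2 * ε * Real.exp (Λ / (2 * ε))) *
        ENNReal.ofReal ‖p.1 - p.2‖ ∂P := by
        refine lintegral_mono fun p => ?_
        exact lintegral_enorm_inner_gradient_le hε hc hf hg hcd hgd hprob hsc p.2 (p.1 - p.2)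
    _ < ⊤ := by
        rw [lintegral_const_mul' _ _ ENNReal.ofReal_ne_top]
        exact ENNReal.mul_lt_top ENNReal.ofReal_lt_top
          ((hasFiniteIntegral_iff_ofReal (ae_of_all _ fun p => norm_nonneg _)).1 hnorm.2)

/-- The integrated difference of the potentials is controlled by the cost of any coupling. -/
lemma integral_potentials_le {ρ : Measure X} [IsProbabilityMeasure ρ] {μ ν : Measure E}
    [IsProbabilityMeasure μ] [IsProbabilityMeasure ν] {ε Λ : ℝ} (hε : 0 < ε)
    {c : X → E → ℝ} {f f' : X → ℝ} {g g' : E → ℝ}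
    (hc : Measurable (Function.uncurry c)) (hf : Measurable f) (hg : Measurable g)
    (hf' : Measurable f') (hg' : Measurable g')
    (hcd : ∀ x, Differentiable ℝ (c x)) (hgd : Differentiable ℝ g)
    (hfst : (plan ρ ν ε c f g).map Prod.fst = ρ)
    [IsProbabilityMeasure (plan ρ μ ε c f' g')]
    (hfst' : (plan ρ μ ε c f' g').map Prod.fst = ρ)
    (hsnd' : (plan ρ μ ε c f' g').map Prod.snd = μ)
    (hprob : ∀ y, IsProbabilityMeasure (condSnd ρ ε c f g y))
    (hgrad : ∀ y, gradient g y = -∫ x, gradient (c x) y ∂(condSnd ρ ε c f g y))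
    (hsc : ∀ᵐ x ∂ρ, Semiconcave Λ (fun y => c x y + g y))
    (hsum : Integrable (fun p : X × E => (f p.1 - f' p.1) / ε + (g p.2 - g' p.2) / ε)
      (plan ρ μ ε c f' g'))
    {P : Measure (E × E)} (hP1 : P.map Prod.fst = μ) (hP2 : P.map Prod.snd = ν)
    (hsq : Integrable (fun p : E × E => ‖p.1 - p.2‖ ^ 2) P) :
    ∫ p, ((f p.1 - f' p.1) / ε + (g p.2 - g' p.2) / ε) ∂(plan ρ μ ε c f' g')
      ≤ Λ / (2 * ε) * ∫ p, ‖p.1 - p.2‖ ^ 2 ∂P := by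
  have : IsProbabilityMeasure P := by
    refine ⟨?_⟩
    have h := measure_univ (μ := μ)
    rwa [← hP1, Measure.map_apply measurable_fst MeasurableSet.univ, Set.preimage_univ] at h
  set Q := gluing ρ P ε c f g with hQ
  have hQsnd : Q.map Prod.snd = P := gluing_map_snd hc hf hg hprob
  have hQfst : Q.map Prod.fst = ρ := by
    rw [← hfst, ← gluing_map_plan hc hf hg hP2, Measure.map_map measurable_fst (by fun_prop)]
    rfl
  have : IsProbabilityMeasure Q := by
    refine ⟨?_⟩
    have h := measure_univ (μ := ρ)
    rwa [← hQfst, Measure.map_apply measurable_fst MeasurableSet.univ, Set.preimage_univ] at h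
  have hQz : Q.map (fun q => q.2.1) = μ := by
    rw [← hP1, ← hQsnd, Measure.map_map measurable_fst measurable_snd]
    rfl
  have hm : Measurable (Function.uncurry fun x y => c x y + g y) := by
    have : Measurable fun p : X × E => c p.1 p.2 := hc
    exact this.add (hg.comp measurable_snd)
  -- the ratio of the densities
  set r : X × E × E → ℝ := fun q => Real.exp ((c q.1 q.2.2 + f q.1 + g q.2.2) / ε
        - (c q.1 q.2.1 + f' q.1 + g' q.2.1) / ε) with hr
  have hrm : Measurable r := by
    have h1 : Measurable fun q : X × E × E => c q.1 q.2.2 :=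
      hc.comp (measurable_fst.prodMk (measurable_snd.comp measurable_snd))
    have h2 : Measurable fun q : X × E × E => c q.1 q.2.1 :=
      hc.comp (measurable_fst.prodMk (measurable_fst.comp measurable_snd))
    fun_prop
  have hr1 : ∫⁻ q, ENNReal.ofReal (r q) ∂Q = 1 := by
    rw [hQ, lintegral_exp_gluing hc hf hg hf' hg' hP1, measure_univ]
  have hrint : Integrable r Q := integrable_of_lintegral_ofReal_ne_top hrm.aestronglyMeasurable
    (fun q => (Real.exp_pos _).le) (by rw [hr1]; exact ENNReal.one_ne_top)
  have hrval : ∫ q, r q ∂Q = 1 := by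
    rw [integral_eq_lintegral_of_nonneg_ae (ae_of_all _ fun q => (Real.exp_pos _).le)
      hrm.aestronglyMeasurable, hr1, ENNReal.toReal_one]
  -- the first-order term
  set G : X × E × E → ℝ := fun q =>
    ⟪gradient (fun y => c q.1 y + g y) q.2.2, q.2.1 - q.2.2⟫ with hG
  have hGm : Measurable G := measurable_inner_gradient hm (fun x => (hcd x).add hgd)
    measurable_fst (measurable_snd.comp measurable_snd) (by fun_prop)
  have hGint : Integrable G Q := integrable_inner_gradient_gluing hε hc hf hg hcd hgd hprob hsc hsq
  have hGval : ∫ q, G q ∂Q = 0 := integral_gluing_eq_zero hc hf hg hGint fun p =>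
    integral_inner_gradient_eq_zero hε hc hf hg hcd hgd hprob hgrad hsc p.2 (p.1 - p.2)
  -- the quadratic term
  have hSm : AEStronglyMeasurable (fun p : E × E => ‖p.1 - p.2‖ ^ 2) (Q.map Prod.snd) := by
    fun_prop
  have hSint : Integrable (fun q : X × E × E => ‖q.2.1 - q.2.2‖ ^ 2) Q := by
    rw [← hQsnd] at hsq
    exact (integrable_map_measure hSm (by fun_prop)).1 hsq
  have hSval : ∫ q, ‖q.2.1 - q.2.2‖ ^ 2 ∂Q = ∫ p, ‖p.1 - p.2‖ ^ 2 ∂P := by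
    rw [← hQsnd, integral_map (by fun_prop) hSm]
  have hrc : Integrable (fun q => r q - 1) Q := hrint.sub (integrable_const 1)
  have hrG : Integrable (fun q => r q - 1 + ε⁻¹ * G q) Q := hrc.add (hGint.const_mul _)
  have hae : ∀ᵐ q ∂Q, (f q.1 - f' q.1) / ε + (g q.2.1 - g' q.2.1) / ε
      ≤ r q - 1 + ε⁻¹ * G q + Λ / (2 * ε) * ‖q.2.1 - q.2.2‖ ^ 2 := by
    rw [← hQfst] at hsc
    filter_upwards [ae_of_ae_map (by fun_prop) hsc] with q hq
    have h1 := Real.add_one_le_exp ((c q.1 q.2.2 + f q.1 + g q.2.2) / ε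
        - (c q.1 q.2.1 + f' q.1 + g' q.2.1) / ε)
    have h2 := div_le_div_of_nonneg_right (hq q.2.2 q.2.1) hε.le
    change _ ≤ (G q + _) / ε at h2
    have e1 : (f q.1 - f' q.1) / ε + (g q.2.1 - g' q.2.1) / ε =
      ((c q.1 q.2.2 + f q.1 + g q.2.2) / ε - (c q.1 q.2.1 + f' q.1 + g' q.2.1) / ε) +
      (c q.1 q.2.1 + g q.2.1 - (c q.1 q.2.2 + g q.2.2)) / ε := by ring
    have e2 : (G q + Λ / 2 * ‖q.2.1 - q.2.2‖ ^ 2) / ε =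
      ε⁻¹ * G q + Λ / (2 * ε) * ‖q.2.1 - q.2.2‖ ^ 2 := by field_simp
    rw [e1]
    change _ + 1 ≤ r q at h1
    linarith
  refine (integral_add_le_of_marginals_eq (A := fun x => (f x - f' x) / ε)
    (B := fun y => (g y - g' y) / ε) measurable_fst (measurable_fst.comp measurable_snd)
    (hQfst.trans hfst'.symm) (hQz.trans hsnd'.symm) (by fun_prop) (by fun_prop) hsum
    (hrG.add (hSint.const_mul (Λ / (2 * ε)))) hae).trans_eq ?_
  simp only [Pi.add_apply]
  rw [integral_add hrG (hSint.const_mul _), integral_add hrc (hGint.const_mul _),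
    integral_sub hrint (integrable_const 1), integral_const_mul, integral_const_mul, hGval, hSval,
    hrval]
  simp

end Potentials

section Divergence

variable {X Y : Type*} [MeasurableSpace X] [MeasurableSpace Y] {ρ : Measure X}
  {μ ν : Measure Y} {ε : ℝ} {c : X → Y → ℝ} {f f' : X → ℝ} {g g' : Y → ℝ}

lemma plan_eq_withDensity [SigmaFinite μ] [SigmaFinite ν] (hμν : μ ≪ ν)
    (hc : Measurable (Function.uncurry c)) (hf : Measurable f) (hg : Measurable g)
    (hf' : Measurable f') (hg' : Measurable g') :
    plan ρ μ ε c f' g' = (plan ρ ν ε c f g).withDensity fun p => μ.rnDeriv ν p.2 *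
      ENNReal.ofReal (Real.exp ((f p.1 - f' p.1) / ε + (g p.2 - g' p.2) / ε)) := by
  have hr : Measurable (μ.rnDeriv ν) := Measure.measurable_rnDeriv μ ν
  conv_lhs => rw [plan, ← Measure.withDensity_rnDeriv_eq μ ν hμν, prod_withDensity_right hr]
  rw [plan, ← withDensity_mul _ (by fun_prop) (measurable_density hc hf' hg'),
    ← withDensity_mul _ (measurable_density hc hf hg) (by fun_prop)]
  congr 1
  funext p
  simp only [Pi.mul_apply]
  rw [mul_left_comm, ← ENNReal.ofReal_mul (Real.exp_pos _).le, ← Real.exp_add]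
  congr 3
  ring

/-- Chain rule for the logarithmic density of one plan with respect to the other. -/
lemma log_rnDeriv_plan_ae_eq [SigmaFinite μ] [SigmaFinite ν] (hμν : μ ≪ ν)
    (hc : Measurable (Function.uncurry c)) (hf : Measurable f) (hg : Measurable g)
    (hf' : Measurable f') (hg' : Measurable g') [SigmaFinite (plan ρ ν ε c f g)]
    (hsnd' : (plan ρ μ ε c f' g').map Prod.snd = μ) :
    (fun p => Real.log ((plan ρ μ ε c f' g').rnDeriv (plan ρ ν ε c f g) p).toReal)
      =ᵐ[plan ρ μ ε c f' g'] fun p => Real.log (μ.rnDeriv ν p.2).toReal +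
        ((f p.1 - f' p.1) / ε + (g p.2 - g' p.2) / ε) := by
  have heq := plan_eq_withDensity (ρ := ρ) (ε := ε) hμν hc hf hg hf' hg'
  have hac : plan ρ μ ε c f' g' ≪ plan ρ ν ε c f g := by
    rw [heq]; exact withDensity_absolutelyContinuous _ _
  have hrn := Measure.rnDeriv_withDensity (plan ρ ν ε c f g)
    (f := fun p => μ.rnDeriv ν p.2 *
      ENNReal.ofReal (Real.exp ((f p.1 - f' p.1) / ε + (g p.2 - g' p.2) / ε)))
    (by have := Measure.measurable_rnDeriv μ ν; fun_prop)
  rw [← heq] at hrn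
  have hpos : ∀ᵐ y ∂μ, 0 < (μ.rnDeriv ν y).toReal := by
    filter_upwards [Measure.rnDeriv_pos hμν, hμν.ae_le (Measure.rnDeriv_lt_top μ ν)] with y h1 h2
    exact ENNReal.toReal_pos h1.ne' h2.ne
  rw [← hsnd'] at hpos
  filter_upwards [hac.ae_le hrn, ae_of_ae_map (by fun_prop) hpos] with p hp hp'
  rw [hsnd'] at hp'
  rw [hp, ENNReal.toReal_mul, ENNReal.toReal_ofReal (Real.exp_pos _).le,
    Real.log_mul hp'.ne' (Real.exp_pos _).ne', Real.log_exp]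

lemma measurable_log_rnDeriv : Measurable fun y => Real.log (μ.rnDeriv ν y).toReal :=
  Real.measurable_log.comp (Measure.measurable_rnDeriv μ ν).ennreal_toReal

lemma integrable_exp_neg_log_rnDeriv [SigmaFinite μ] [IsFiniteMeasure ν] (hμν : μ ≪ ν) :
    Integrable (fun y => Real.exp (-Real.log (μ.rnDeriv ν y).toReal)) μ := by
  refine integrable_of_lintegral_ofReal_ne_top
    (Real.measurable_exp.comp measurable_log_rnDeriv.neg).aestronglyMeasurable
    (fun y => (Real.exp_pos _).le) ?_
  refine ne_top_of_le_ne_top (measure_ne_top ν Set.univ)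
    ((lintegral_mono_ae ?_).trans (Measure.lintegral_rnDeriv_le (μ := ν) (ν := μ)))
  filter_upwards [Measure.rnDeriv_pos hμν, hμν.ae_le (Measure.rnDeriv_lt_top μ ν),
    Measure.inv_rnDeriv hμν] with y h1 h2 h3
  have h4 := ENNReal.toReal_pos h1.ne' h2.ne
  rw [← h3, Real.exp_neg, Real.exp_log h4, ENNReal.ofReal_inv_of_pos h4,
    ENNReal.ofReal_toReal h2.ne, Pi.inv_apply]

lemma integrable_exp_neg_potentials [SFinite ρ] [IsFiniteMeasure μ]
    (hc : Measurable (Function.uncurry c)) (hf : Measurable f) (hg : Measurable g)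
    (hf' : Measurable f') (hg' : Measurable g')
    (hprob : ∀ y, IsProbabilityMeasure (condSnd ρ ε c f g y)) :
    Integrable (fun p : X × Y => Real.exp (-((f p.1 - f' p.1) / ε + (g p.2 - g' p.2) / ε)))
      (plan ρ μ ε c f' g') := by
  refine integrable_of_lintegral_ofReal_ne_top (by fun_prop) (fun y => (Real.exp_pos _).le) ?_
  have : ∫⁻ p : X × Y, ENNReal.ofReal
      (Real.exp (-((f p.1 - f' p.1) / ε + (g p.2 - g' p.2) / ε))) ∂(plan ρ μ ε c f' g')
      = ∫⁻ p, ENNReal.ofReal (Real.exp (-(c p.1 p.2 + f p.1 + g p.2) / ε)) ∂(ρ.prod μ) := by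
    rw [plan, lintegral_withDensity_eq_lintegral_mul _ (measurable_density hc hf' hg')
      (by fun_prop)]
    refine lintegral_congr fun p => ?_
    rw [Pi.mul_apply, ← ENNReal.ofReal_mul (Real.exp_pos _).le, ← Real.exp_add]
    congr 2
    ring
  rw [this, lintegral_prod_symm' _ (measurable_density hc hf hg)]
  simp_rw [lintegral_density_eq_one hprob]
  rw [lintegral_one]
  exact measure_ne_top μ _

/-- Either the divergence of the plans degenerates, or it splits as the divergence of the second
marginals plus the integrated difference of the potentials. -/
lemma KL_plan_le [SFinite ρ] [IsFiniteMeasure μ] [IsFiniteMeasure ν] (hμν : μ ≪ ν)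
    (hc : Measurable (Function.uncurry c)) (hf : Measurable f) (hg : Measurable g)
    (hf' : Measurable f') (hg' : Measurable g') [SigmaFinite (plan ρ ν ε c f g)]
    (hsnd' : (plan ρ μ ε c f' g').map Prod.snd = μ)
    (hprob : ∀ y, IsProbabilityMeasure (condSnd ρ ε c f g y)) {C : ℝ}
    (hC : Integrable (fun p : X × Y => (f p.1 - f' p.1) / ε + (g p.2 - g' p.2) / ε)
        (plan ρ μ ε c f' g') →
      ∫ p, ((f p.1 - f' p.1) / ε + (g p.2 - g' p.2) / ε) ∂(plan ρ μ ε c f' g') ≤ C) :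
    KL (plan ρ μ ε c f' g') (plan ρ ν ε c f g) ≤ KL μ ν + ENNReal.ofReal C := by
  have hac : plan ρ μ ε c f' g' ≪ plan ρ ν ε c f g := by
    rw [plan_eq_withDensity hμν hc hf hg hf' hg']; exact withDensity_absolutelyContinuous _ _
  have hlog := log_rnDeriv_plan_ae_eq (ρ := ρ) (ε := ε) hμν hc hf hg hf' hg' hsnd'
  rw [KL, KL, if_pos hac, if_pos hμν, integral_congr_ae hlog]
  by_cases hsum : Integrable (fun p : X × Y => Real.log (μ.rnDeriv ν p.2).toReal +
        ((f p.1 - f' p.1) / ε + (g p.2 - g' p.2) / ε)) (plan ρ μ ε c f' g')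
  swap
  · rw [integral_undef hsum]; simp
  have hL : Measurable fun y => Real.log (μ.rnDeriv ν y).toReal := measurable_log_rnDeriv
  have hLe : Integrable (fun p : X × Y => Real.exp (-Real.log (μ.rnDeriv ν p.2).toReal))
      (plan ρ μ ε c f' g') := by
    refine Integrable.comp_measurable (f := Prod.snd)
      (g := fun y => Real.exp (-Real.log (μ.rnDeriv ν y).toReal)) ?_ measurable_snd
    rw [hsnd']
    exact integrable_exp_neg_log_rnDeriv hμν
  have hDe := integrable_exp_neg_potentials (μ := μ) hc hf hg hf' hg' hprob
  have hLint := integrable_left_of_add_of_exp_neg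
    (f := fun p : X × Y => Real.log (μ.rnDeriv ν p.2).toReal)
    (hL.comp measurable_snd).aestronglyMeasurable hsum hLe hDe
  have hDint := integrable_left_of_add_of_exp_neg (g := fun p : X × Y =>
    Real.log (μ.rnDeriv ν p.2).toReal) (by fun_prop) (by simpa only [add_comm] using hsum) hDe hLe
  have hLval : ∫ p, Real.log (μ.rnDeriv ν p.2).toReal ∂(plan ρ μ ε c f' g')
      = ∫ y, Real.log (μ.rnDeriv ν y).toReal ∂μ := by
    rw [← integral_map (φ := Prod.snd) (f := fun y => Real.log (μ.rnDeriv ν y).toReal)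
      (by fun_prop) hL.aestronglyMeasurable, hsnd']
  rw [integral_add hLint hDint, hLval]
  exact ENNReal.ofReal_add_le.trans (by gcongr; exact hC hDint)

end Divergence

end KLStability

/-- **KL stability of optimal plans** (Theorem 1.2). -/
theorem kl_stability_of_optimal_plans
    {X : Type*} [MeasurableSpace X] [TopologicalSpace X] [PolishSpace X] [BorelSpace X]
    {d : ℕ} (ρ : Measure X) [IsProbabilityMeasure ρ]
    (μ ν : Measure (EuclideanSpace ℝ (Fin d))) [IsProbabilityMeasure μ] [IsProbabilityMeasure ν]
    (ε : ℝ) (hε : 0 < ε)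
    (c : X → EuclideanSpace ℝ (Fin d) → ℝ)
    (hc_meas : Measurable (Function.uncurry c))
    (hc_smooth : ∀ x, ContDiff ℝ 1 (c x))
    (φν : X → ℝ) (ψν : EuclideanSpace ℝ (Fin d) → ℝ) (φμ : X → ℝ) (ψμ : EuclideanSpace ℝ (Fin d) → ℝ)
    (hφν_meas : Measurable φν) (hψν_meas : Measurable ψν)
    (hφμ_meas : Measurable φμ) (hψμ_meas : Measurable ψμ)
    (hπν_prob : IsProbabilityMeasure (plan ρ ν ε c φν ψν))
    (hπν_fst : (plan ρ ν ε c φν ψν).map Prod.fst = ρ)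
    (hπν_snd : (plan ρ ν ε c φν ψν).map Prod.snd = ν)
    (hπμ_prob : IsProbabilityMeasure (plan ρ μ ε c φμ ψμ))
    (hπμ_fst : (plan ρ μ ε c φμ ψμ).map Prod.fst = ρ)
    (hπμ_snd : (plan ρ μ ε c φμ ψμ).map Prod.snd = μ)
    (hcond : ∀ y, IsProbabilityMeasure (condSnd ρ ε c φν ψν y))
    (hψν_diff : Differentiable ℝ ψν)
    (hψν_grad : ∀ y, gradient ψν y = -∫ x, gradient (c x) y ∂(condSnd ρ ε c φν ψν y))
    (Λ : ℝ) (hΛ : 0 < Λ)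
    (hsc : ∀ x ∈ msupport ρ, Semiconcave Λ (fun y => c x y + ψν y)) :
    KL (plan ρ μ ε c φμ ψμ) (plan ρ ν ε c φν ψν)
      ≤ KL μ ν + ENNReal.ofReal (Λ / (2 * ε)) * W2sq μ ν := by
  by_cases hμν : μ ≪ ν
  swap
  · rw [KL, KL, if_neg hμν]
    simp
  have hΛε : 0 < Λ / (2 * ε) := by positivity
  have hae : ∀ᵐ x ∂ρ, Semiconcave Λ (fun y => c x y + ψν y) := by
    filter_upwards [KLStability.ae_mem_msupport ρ] with x hx using hsc x hx
  rw [W2sq, Wcost, ENNReal.mul_iInf_of_ne (by simpa using hΛε) ENNReal.ofReal_ne_top,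
    ENNReal.add_iInf]
  refine le_iInf fun P => ?_
  by_cases hP : P.map Prod.fst = μ ∧ P.map Prod.snd = ν
  swap
  · rw [iInf_neg hP, ENNReal.mul_top (by simpa using hΛε), add_top]
    exact le_top
  rw [iInf_pos hP]
  rcases eq_or_ne (∫⁻ p, ENNReal.ofReal (‖p.1 - p.2‖ ^ 2) ∂P) ⊤ with htop | htop
  · rw [htop, ENNReal.mul_top (by simpa using hΛε), add_top]
    exact le_top
  have hsq : Integrable (fun p : EuclideanSpace ℝ (Fin d) × EuclideanSpace ℝ (Fin d) =>
      ‖p.1 - p.2‖ ^ 2) P :=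
    KLStability.integrable_of_lintegral_ofReal_ne_top (by fun_prop) (fun p => by positivity) htop
  rw [← ofReal_integral_eq_lintegral_ofReal hsq (ae_of_all _ fun p => by positivity),
    ← ENNReal.ofReal_mul hΛε.le]
  exact KLStability.KL_plan_le hμν hc_meas hφν_meas hψν_meas hφμ_meas hψμ_meas hπμ_snd hcond
    fun hsum => KLStability.integral_potentials_le hε hc_meas hφν_meas hψν_meas hφμ_meas hψμ_meas
      (fun x => (hc_smooth x).differentiable one_ne_zero) hψν_diff hπν_fst hπμ_fst hπμ_snd hcond
      hψν_grad hae hsum hP.1 hP.2 hsq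
end
end

section
/- Let U : ℝ^d → ℝ be twice continuously differentiable with ∫ e^{−U(x)} dx = 1, and let π be the probability measure with density e^{−U} with respect to the Lebesgue measure. Let α > 0 and L, R ≥ 0, and suppose ∇²U(x) ⪰ −L·Id for |x| < R and ∇²U(x) ⪰ α·Id for |x| ≥ R. Let f : ℝ^d → ℝ^d be Lipschitz with Lipschitz constant ℓ. Then for every unit vector v ∈ ℝ^d: Var_{X∼π}(⟨f(X), v⟩) ≤ 2ℓ²·(α^{−1} + α^{−2}·(L+α)²·R²). -/
open MeasureTheory Real ENNReal
open scoped RealInnerProductSpace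

noncomputable section

/-- The one-dimensional Brunn–Minkowski inequality. -/
theorem Real.volume_add_volume_le {A B S : Set ℝ} (hA : MeasurableSet A) (hB : MeasurableSet B)
    (hA' : A.Nonempty) (hB' : B.Nonempty) (h : ∀ x ∈ A, ∀ y ∈ B, x + y ∈ S) :
    volume A + volume B ≤ volume S := by
  have key : ∀ K L : Set ℝ, IsCompact K → IsCompact L → K.Nonempty → L.Nonempty →
      (∀ x ∈ K, ∀ y ∈ L, x + y ∈ S) → volume K + volume L ≤ volume S := by
    intro K L hK hL hKn hLn hS
    have hp := hK.sSup_mem hKn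
    have hq := hL.sInf_mem hLn
    set p := sSup K
    set q := sInf L
    have e1 : volume ((fun x => x + q) '' K) = volume K := by
      rw [Set.image_add_right]; exact measure_preimage_add_right _ _ _
    have e2 : volume ((fun x => p + x) '' L) = volume L := by
      rw [Set.image_add_left]; exact measure_preimage_add _ _ _
    rw [← e1, ← e2, ← measure_union₀]
    · refine measure_mono ?_
      rintro _ (⟨x, hx, rfl⟩ | ⟨y, hy, rfl⟩)
      · exact hS x hx q hq
      · exact hS p hp y hy
    · exact (hL.image (by fun_prop)).measurableSet.nullMeasurableSet
    · refine measure_mono_null (t := {p + q}) ?_ (by simp)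
      rintro _ ⟨⟨x, hx, rfl⟩, ⟨y, hy, hxy⟩⟩
      have h1 : x ≤ p := le_csSup hK.bddAbove hx
      have h2 : q ≤ y := csInf_le hL.bddBelow hy
      simp only [Set.mem_singleton_iff] at *
      linarith
  obtain ⟨a, ha⟩ := hA'
  obtain ⟨b, hb⟩ := hB'
  rw [hA.measure_eq_iSup_isCompact, hB.measure_eq_iSup_isCompact]
  simp_rw [iSup_and']
  refine ENNReal.biSup_add_biSup_le' ⟨∅, by simp⟩ ⟨∅, by simp⟩ fun K ⟨hKA, hK⟩ L ⟨hLB, hL⟩ => ?_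
  refine le_trans (add_le_add (measure_mono (Set.subset_insert a K))
    (measure_mono (Set.subset_insert b L))) (key _ _ (hK.insert a) (hL.insert b)
    (Set.insert_nonempty _ _) (Set.insert_nonempty _ _) fun x hx y hy => h x ?_ y ?_)
  · exact Set.insert_subset ha hKA hx
  · exact Set.insert_subset hb hLB hy

theorem ENNReal.rpow_mul_rpow_le_add {a b : ℝ} (ha : 0 < a) (hb : 0 < b) (hab : a + b = 1)
    (x y : ℝ≥0∞) : x ^ a * y ^ b ≤ ENNReal.ofReal a * x + ENNReal.ofReal b * y := by
  have hpq : (a⁻¹).HolderConjugate b⁻¹ := by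
    rw [Real.holderConjugate_iff]
    refine ⟨(one_lt_inv₀ ha).2 (by linarith), by simpa using hab⟩
  have := ENNReal.young_inequality (x ^ a) (y ^ b) hpq
  rw [← ENNReal.rpow_mul, ← ENNReal.rpow_mul, mul_inv_cancel₀ ha.ne', mul_inv_cancel₀ hb.ne',
    ENNReal.rpow_one, ENNReal.rpow_one, ENNReal.ofReal_inv_of_pos ha, ENNReal.ofReal_inv_of_pos hb,
    ENNReal.div_eq_inv_mul, ENNReal.div_eq_inv_mul, inv_inv, inv_inv] at this
  exact this

open scoped Pointwise in
/-- The one-dimensional Prékopa–Leindler inequality for functions with supremum one. -/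
theorem Real.lintegral_add_le_of_iSup_eq_one {a b : ℝ} (ha : 0 < a) (hb : 0 < b) (hab : a + b = 1)
    {f g h : ℝ → ℝ} (hf : Measurable f) (hg : Measurable g) (hh : Measurable h)
    (hf0 : 0 ≤ f) (hg0 : 0 ≤ g) (hh0 : 0 ≤ h) (hf1 : ∀ x, f x ≤ 1) (hg1 : ∀ x, g x ≤ 1)
    (hfs : ∀ s < 1, ∃ x, s < f x) (hgs : ∀ s < 1, ∃ x, s < g x)
    (hfgh : ∀ x y, f x ^ a * g y ^ b ≤ h (a * x + b * y)) :
    ENNReal.ofReal a * (∫⁻ x, ENNReal.ofReal (f x)) + ENNReal.ofReal b * (∫⁻ x, ENNReal.ofReal (g x))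
      ≤ ∫⁻ x, ENNReal.ofReal (h x) := by
  rw [lintegral_eq_lintegral_meas_lt _ (.of_forall hf0) hf.aemeasurable,
    lintegral_eq_lintegral_meas_lt _ (.of_forall hg0) hg.aemeasurable,
    lintegral_eq_lintegral_meas_lt _ (.of_forall hh0) hh.aemeasurable,
    ← lintegral_const_mul' _ _ (by simp), ← lintegral_const_mul' _ _ (by simp)]
  refine (le_lintegral_add _ _).trans (setLIntegral_mono' measurableSet_Ioi fun s hs => ?_)
  have hs0 : 0 < s := hs
  rcases le_or_gt 1 s with h1 | h1
  · have e1 : {x | s < f x} = ∅ := by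
      ext x; simpa using (hf1 x).trans h1
    have e2 : {x | s < g x} = ∅ := by
      ext x; simpa using (hg1 x).trans h1
    simp [e1, e2]
  · have e : ∀ (c : ℝ) (_ : 0 < c) (T : Set ℝ), ENNReal.ofReal c * volume T = volume (c • T) := by
      intro c hc T
      rw [Measure.addHaar_smul]
      simp [abs_of_pos hc]
    rw [e a ha, e b hb]
    refine Real.volume_add_volume_le ?_ ?_ ?_ ?_ ?_
    · exact (measurableSet_lt measurable_const hf).const_smul₀ a
    · exact (measurableSet_lt measurable_const hg).const_smul₀ b
    · exact Set.Nonempty.smul_set (hfs s h1)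
    · exact Set.Nonempty.smul_set (hgs s h1)
    · rintro _ ⟨x, hx, rfl⟩ _ ⟨y, hy, rfl⟩
      refine lt_of_lt_of_le ?_ (hfgh x y)
      have hx' : s < f x := hx
      have hy' : s < g y := hy
      calc s = s ^ a * s ^ b := by rw [← Real.rpow_add hs0, hab, Real.rpow_one]
        _ < f x ^ a * g y ^ b := by
          have := Real.rpow_lt_rpow hs0.le hx' ha
          have := Real.rpow_lt_rpow hs0.le hy' hb
          gcongr

theorem Real.prekopa_leindler_of_bddAbove {a b : ℝ} (ha : 0 < a) (hb : 0 < b) (hab : a + b = 1)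
    {f g h : ℝ → ℝ} (hf : Measurable f) (hg : Measurable g) (hh : Measurable h)
    (hf0 : 0 ≤ f) (hg0 : 0 ≤ g) (hh0 : 0 ≤ h)
    (hfb : BddAbove (Set.range f)) (hgb : BddAbove (Set.range g))
    (hfgh : ∀ x y, f x ^ a * g y ^ b ≤ h (a * x + b * y)) :
    (∫⁻ x, ENNReal.ofReal (f x)) ^ a * (∫⁻ x, ENNReal.ofReal (g x)) ^ b
      ≤ ∫⁻ x, ENNReal.ofReal (h x) := by
  have main : ∀ {φ : ℝ → ℝ}, 0 ≤ φ → BddAbove (Set.range φ) →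
      φ = 0 ∨ ∃ A > 0, (∀ x, φ x / A ≤ 1) ∧ ∀ s < 1, ∃ x, s < φ x / A := by
    intro φ h0 hb
    rcases (Real.iSup_nonneg h0).eq_or_lt with h | h
    · left
      ext x
      exact le_antisymm ((le_ciSup hb x).trans h.ge) (h0 x)
    · refine .inr ⟨_, h, fun x => (div_le_one h).2 (le_ciSup hb x), fun s hs => ?_⟩
      obtain ⟨x, hx⟩ := exists_lt_of_lt_ciSup (f := φ) (b := s * ⨆ x, φ x) (by nlinarith)
      exact ⟨x, (lt_div_iff₀ h).2 hx⟩
  rcases main hf0 hfb with rfl | ⟨A, hA, hf1, hfs⟩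
  · simp [ENNReal.zero_rpow_of_pos ha]
  rcases main hg0 hgb with rfl | ⟨B, hB, hg1, hgs⟩
  · simp [ENNReal.zero_rpow_of_pos hb]
  have hC : 0 < A ^ a * B ^ b := by positivity
  have := Real.lintegral_add_le_of_iSup_eq_one ha hb hab (hf.div_const A) (hg.div_const B)
    (hh.div_const (A ^ a * B ^ b)) (fun x => div_nonneg (hf0 x) hA.le)
    (fun x => div_nonneg (hg0 x) hB.le) (fun x => div_nonneg (hh0 x) hC.le) hf1 hg1 hfs hgs (by
      intro x y
      rw [Real.div_rpow (hf0 x) hA.le, Real.div_rpow (hg0 y) hB.le, div_mul_div_comm]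
      exact div_le_div_of_nonneg_right (hfgh x y) hC.le)
  have e : ∀ (c : ℝ) (_ : 0 < c) {φ : ℝ → ℝ}, Measurable φ →
      ∫⁻ x, ENNReal.ofReal (φ x) = ENNReal.ofReal c * ∫⁻ x, ENNReal.ofReal (φ x / c) := by
    intro c hc φ hφ
    rw [← lintegral_const_mul _ (by fun_prop)]
    congr with x
    rw [← ENNReal.ofReal_mul hc.le, mul_div_cancel₀ _ hc.ne']
  rw [e A hA hf, e B hB hg, e _ hC hh, ENNReal.mul_rpow_of_nonneg _ _ ha.le,
    ENNReal.mul_rpow_of_nonneg _ _ hb.le, ENNReal.ofReal_mul (by positivity),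
    ENNReal.ofReal_rpow_of_pos hA, ENNReal.ofReal_rpow_of_pos hB, mul_mul_mul_comm]
  gcongr
  exact (ENNReal.rpow_mul_rpow_le_add ha hb hab _ _).trans this

/-- The one-dimensional **Prékopa–Leindler inequality**. -/
theorem Real.prekopa_leindler {a b : ℝ} (ha : 0 < a) (hb : 0 < b) (hab : a + b = 1)
    {f g h : ℝ → ℝ≥0∞} (hf : Measurable f) (hg : Measurable g) (hh : Measurable h)
    (hfgh : ∀ x y, f x ^ a * g y ^ b ≤ h (a * x + b * y)) :
    (∫⁻ x, f x) ^ a * (∫⁻ x, g x) ^ b ≤ ∫⁻ x, h x := by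
  have ofr : ∀ (n : ℕ) (x : ℝ≥0∞), ENNReal.ofReal (min x n).toReal = min x n := fun n x =>
    ENNReal.ofReal_toReal (ne_top_of_le_ne_top (ENNReal.natCast_ne_top n) (min_le_right _ _))
  have trunc : ∀ n : ℕ, (∫⁻ x, min (f x) n) ^ a * (∫⁻ x, min (g x) n) ^ b ≤ ∫⁻ x, h x := by
    intro n
    have bdd : ∀ φ : ℝ → ℝ≥0∞, BddAbove (Set.range fun x => (min (φ x) n).toReal) := by
      refine fun φ => ⟨n, ?_⟩
      rintro _ ⟨x, rfl⟩
      simpa using ENNReal.toReal_mono (ENNReal.natCast_ne_top n) (min_le_right (φ x) (n : ℝ≥0∞))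
    have := Real.prekopa_leindler_of_bddAbove ha hb hab (f := fun x => (min (f x) n).toReal)
      (g := fun x => (min (g x) n).toReal) (h := fun x => (min (h x) n).toReal)
      (by fun_prop) (by fun_prop) (by fun_prop) (fun _ => toReal_nonneg) (fun _ => toReal_nonneg)
      (fun _ => toReal_nonneg) (bdd f) (bdd g) (by
        intro x y
        rw [ENNReal.toReal_rpow, ENNReal.toReal_rpow, ← ENNReal.toReal_mul]
        refine ENNReal.toReal_mono
          (ne_top_of_le_ne_top (ENNReal.natCast_ne_top n) (min_le_right _ _)) (le_min ?_ ?_)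
        · refine le_trans ?_ (hfgh x y)
          gcongr <;> exact min_le_left _ _
        · calc min (f x) (n : ℝ≥0∞) ^ a * min (g y) (n : ℝ≥0∞) ^ b
              ≤ (n : ℝ≥0∞) ^ a * (n : ℝ≥0∞) ^ b := by
                gcongr <;> exact min_le_right _ _
            _ = n := by
              rw [← ENNReal.rpow_add_of_nonneg _ _ ha.le hb.le, hab, ENNReal.rpow_one])
    simp only [ofr] at this
    exact this.trans (lintegral_mono fun x => min_le_left _ _)
  have mct : ∀ {φ : ℝ → ℝ≥0∞}, Measurable φ → ∫⁻ x, φ x = ⨆ n : ℕ, ∫⁻ x, min (φ x) n := by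
    intro φ hφ
    rw [← lintegral_iSup (fun n => hφ.min measurable_const)
      (fun m n hmn x => min_le_min le_rfl (by exact_mod_cast hmn))]
    congr with x
    rw [← inf_iSup_eq, ENNReal.iSup_natCast, inf_top_eq]
  have rpow_iSup : ∀ {c : ℝ} (_ : 0 < c) (u : ℕ → ℝ≥0∞), (⨆ n, u n) ^ c = ⨆ n, u n ^ c :=
    fun hc u => (ENNReal.orderIsoRpow _ hc).map_iSup u
  rw [mct hf, mct hg, rpow_iSup ha, rpow_iSup hb, ENNReal.iSup_mul]
  refine iSup_le fun m => ?_
  rw [ENNReal.mul_iSup]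
  refine iSup_le fun n => le_trans ?_ (trunc (max m n))
  gcongr <;> simp

/-- The **Prékopa–Leindler inequality** on `Fin n → ℝ`. -/
theorem prekopa_leindler_pi {a b : ℝ} (ha : 0 < a) (hb : 0 < b) (hab : a + b = 1) (n : ℕ)
    {f g h : (Fin n → ℝ) → ℝ≥0∞} (hf : Measurable f) (hg : Measurable g) (hh : Measurable h)
    (hfgh : ∀ x y, f x ^ a * g y ^ b ≤ h (a • x + b • y)) :
    (∫⁻ x, f x) ^ a * (∫⁻ x, g x) ^ b ≤ ∫⁻ x, h x := by
  induction n with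
  | zero =>
    have := hfgh 0 0
    have hvol : (volume : Measure (Fin 0 → ℝ)) = Measure.dirac 0 := by
      rw [volume_pi, Measure.pi_of_empty _ 0]
    rw [hvol, lintegral_dirac' _ hf, lintegral_dirac' _ hg, lintegral_dirac' _ hh]
    simpa using this
  | succ n ih =>
    let e := (MeasurableEquiv.piFinSuccAbove (fun _ : Fin (n + 1) => ℝ) 0).symm
    have he : MeasurePreserving e :=
      (volume_preserving_piFinSuccAbove (fun _ : Fin (n + 1) => ℝ) 0).symm
    have fub : ∀ {φ : (Fin (n + 1) → ℝ) → ℝ≥0∞}, Measurable φ →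
        ∫⁻ x, φ x = ∫⁻ t : ℝ, ∫⁻ y : Fin n → ℝ, φ (e (t, y)) := by
      intro φ hφ
      rw [← he.lintegral_comp hφ]
      exact lintegral_prod _ (hφ.comp e.measurable).aemeasurable
    have meas : ∀ {φ : (Fin (n + 1) → ℝ) → ℝ≥0∞}, Measurable φ →
        Measurable fun t : ℝ => ∫⁻ y : Fin n → ℝ, φ (e (t, y)) := fun hφ =>
      (hφ.comp e.measurable).lintegral_prod_right'
    rw [fub hf, fub hg, fub hh]
    refine Real.prekopa_leindler ha hb hab (meas hf) (meas hg) (meas hh) fun s t => ?_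
    have sec : ∀ {φ : (Fin (n + 1) → ℝ) → ℝ≥0∞}, Measurable φ → ∀ t : ℝ,
        Measurable fun y : Fin n → ℝ => φ (e (t, y)) := fun hφ t =>
      hφ.comp (e.measurable.comp measurable_prodMk_left)
    refine ih (sec hf s) (sec hg t) (sec hh _) fun x y => ?_
    refine (hfgh _ _).trans_eq ?_
    congr 1
    ext i
    refine Fin.cases ?_ (fun j => ?_) i <;> simp [e, MeasurableEquiv.piFinSuccAbove]

/-- The **Prékopa–Leindler inequality** on Euclidean space. -/
theorem EuclideanSpace.prekopa_leindler {a b : ℝ} (ha : 0 < a) (hb : 0 < b) (hab : a + b = 1)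
    {n : ℕ} {f g h : EuclideanSpace ℝ (Fin n) → ℝ≥0∞} (hf : Measurable f) (hg : Measurable g)
    (hh : Measurable h) (hfgh : ∀ x y, f x ^ a * g y ^ b ≤ h (a • x + b • y)) :
    (∫⁻ x, f x) ^ a * (∫⁻ x, g x) ^ b ≤ ∫⁻ x, h x := by
  have e := PiLp.volume_preserving_toLp (Fin n)
  rw [← e.lintegral_comp hf, ← e.lintegral_comp hg, ← e.lintegral_comp hh]
  exact prekopa_leindler_pi ha hb hab n (hf.comp e.measurable) (hg.comp e.measurable)
    (hh.comp e.measurable) fun x y => hfgh _ _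

theorem continuous_of_abs_sub_le {E : Type*} [SeminormedAddCommGroup E] {g : E → ℝ} {K : ℝ}
    (hg : ∀ x y, |g x - g y| ≤ K * ‖x - y‖) : Continuous g := by
  refine LipschitzWith.continuous (K := K.toNNReal) (LipschitzWith.of_dist_le_mul fun x y => ?_)
  rw [Real.dist_eq, dist_eq_norm]
  exact (hg x y).trans (mul_le_mul_of_nonneg_right (Real.le_coe_toNNReal K) (norm_nonneg _))

theorem abs_le_mul_exp_norm {E : Type*} [SeminormedAddCommGroup E] {g : E → ℝ} {K : ℝ}
    (hK : 0 ≤ K) (hg : ∀ x y, |g x - g y| ≤ K * ‖x - y‖) (x : E) :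
    |g x| ≤ (|g 0| + K) * Real.exp ‖x‖ := by
  have h1 : |g x - g 0| ≤ K * ‖x‖ := by simpa using hg x 0
  have h2 : |g x| ≤ |g 0| + |g x - g 0| := by
    simpa using abs_add_le (g 0) (g x - g 0)
  have h3 := Real.add_one_le_exp ‖x‖
  have h4 := norm_nonneg x
  nlinarith [abs_nonneg (g 0)]

theorem le_of_forall_mul_le_of_lt_one {B e : ℝ} (hB : 0 ≤ B)
    (h : ∀ a : ℝ, 0 < a → a < 1 → a * e ≤ B) : e ≤ B := by
  by_contra! hlt
  have he : 0 < e := hB.trans_lt hlt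
  have h1 : (B / e + 1) / 2 < 1 := by linarith [(div_lt_one he).2 hlt]
  have h2 := h _ (by positivity) h1
  have h3 : (B / e + 1) / 2 * e = (B + e) / 2 := by field_simp
  linarith

theorem ENNReal.ofReal_exp_rpow (l a : ℝ) :
    ENNReal.ofReal (Real.exp l) ^ a = ENNReal.ofReal (Real.exp (a * l)) := by
  rw [ENNReal.ofReal_rpow_of_pos (Real.exp_pos l), ← Real.exp_mul, mul_comm]

theorem ENNReal.ofReal_exp_mul_ofReal_exp (l m : ℝ) :
    ENNReal.ofReal (Real.exp l) * ENNReal.ofReal (Real.exp m) =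
      ENNReal.ofReal (Real.exp (l + m)) := by
  rw [← ENNReal.ofReal_mul (Real.exp_pos l).le, Real.exp_add]

theorem ENNReal.ofReal_exp_le_ofReal_exp {l m : ℝ} :
    ENNReal.ofReal (Real.exp l) ≤ ENNReal.ofReal (Real.exp m) ↔ l ≤ m := by
  rw [ENNReal.ofReal_le_ofReal_iff (Real.exp_pos m).le, Real.exp_le_exp]

/-- Jensen's inequality for the exponential. -/
theorem ofReal_exp_integral_le_lintegral {Ω : Type*} [MeasurableSpace Ω] {μ : Measure Ω}
    [IsProbabilityMeasure μ] {X : Ω → ℝ} (hX : Integrable X μ) :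
    ENNReal.ofReal (Real.exp (∫ x, X x ∂μ)) ≤ ∫⁻ x, ENNReal.ofReal (Real.exp (X x)) ∂μ := by
  by_cases hi : Integrable (fun x => Real.exp (X x)) μ
  · rw [← ofReal_integral_eq_lintegral_ofReal hi (.of_forall fun x => (Real.exp_pos _).le)]
    exact ENNReal.ofReal_le_ofReal (convexOn_exp.map_integral_le Real.continuous_exp.continuousOn
      isClosed_univ (.of_forall fun _ => Set.mem_univ _) hX hi)
  · have hm : AEStronglyMeasurable (fun x => Real.exp (X x)) μ :=
      Real.continuous_exp.comp_aestronglyMeasurable hX.1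
    have htop : ∫⁻ x, ENNReal.ofReal (Real.exp (X x)) ∂μ = ∞ := by
      by_contra hne
      exact hi ((lintegral_ofReal_ne_top_iff_integrable hm
        (.of_forall fun x => (Real.exp_pos _).le)).1 hne)
    simp [htop]

/-- The measure with density `exp (-U)`. -/
def gibbs {E : Type*} [MeasureSpace E] (U : E → ℝ) : Measure E :=
  volume.withDensity fun x => ENNReal.ofReal (Real.exp (-U x))

section gibbs

variable {E : Type*} [MeasureSpace E]

theorem lintegral_exp_gibbs {U p : E → ℝ} (hU : Measurable U) (hp : Measurable p) :
    ∫⁻ x, ENNReal.ofReal (Real.exp (p x)) ∂gibbs U =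
      ∫⁻ x, ENNReal.ofReal (Real.exp (p x - U x)) := by
  rw [gibbs, lintegral_withDensity_eq_lintegral_mul _ (by fun_prop) (by fun_prop)]
  refine lintegral_congr fun x => ?_
  rw [Pi.mul_apply, ENNReal.ofReal_exp_mul_ofReal_exp]
  congr 2
  ring

theorem lintegral_exp_gibbs_sub {V φ p : E → ℝ} (hV : Measurable V) (hφ : Measurable φ)
    (hp : Measurable p) :
    ∫⁻ x, ENNReal.ofReal (Real.exp (p x)) ∂gibbs (fun x => V x - φ x) =
      ∫⁻ x, ENNReal.ofReal (Real.exp (p x + φ x)) ∂gibbs V := by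
  rw [lintegral_exp_gibbs (by fun_prop) hp, lintegral_exp_gibbs hV (by fun_prop)]
  refine lintegral_congr fun x => ?_
  congr 2
  ring

theorem isProbabilityMeasure_gibbs {U : E → ℝ} (hU : ∫ x, Real.exp (-U x) = 1) :
    IsProbabilityMeasure (gibbs U) := by
  have hi : Integrable fun x => Real.exp (-U x) := by
    by_contra h
    rw [integral_undef h] at hU
    exact zero_ne_one hU
  refine ⟨?_⟩
  rw [gibbs, withDensity_apply _ .univ, Measure.restrict_univ,
    ← ofReal_integral_eq_lintegral_ofReal hi (.of_forall fun x => (Real.exp_pos _).le), hU,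
    ENNReal.ofReal_one]

theorem integrable_gibbs_of_abs_le {E : Type*} [NormedAddCommGroup E] [MeasureSpace E]
    [BorelSpace E] [SecondCountableTopology E] {U u : E → ℝ} (hU : Continuous U)
    (hu : Continuous u) {c C : ℝ}
    (hi : Integrable fun x => Real.exp (c * ‖x‖ - U x)) (h : ∀ x, |u x| ≤ C * Real.exp (c * ‖x‖)) :
    Integrable u (gibbs U) := by
  rw [gibbs, integrable_withDensity_iff_integrable_smul' (by fun_prop) (by simp)]
  simp_rw [ENNReal.toReal_ofReal (Real.exp_pos _).le, smul_eq_mul]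
  refine (hi.const_mul C).mono' (by fun_prop) (.of_forall fun x => ?_)
  rw [norm_mul, Real.norm_eq_abs,
    Real.norm_eq_abs, abs_of_pos (Real.exp_pos _), sub_eq_add_neg, Real.exp_add]
  nlinarith [mul_le_mul_of_nonneg_left (h x) (Real.exp_pos (-U x)).le]

end gibbs

/-- A continuous uniformly convex function grows quadratically. -/
theorem StrongConvexOn.exists_quadratic_le {E : Type*} [NormedAddCommGroup E] [NormedSpace ℝ E]
    [ProperSpace E] {V : E → ℝ} {α : ℝ} (hV : StrongConvexOn Set.univ α V) (hα : 0 < α)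
    (hc : Continuous V) : ∃ C, 0 ≤ C ∧ ∀ x, α / 2 * ‖x‖ ^ 2 - C * (‖x‖ + 1) ≤ V x := by
  obtain ⟨B, hB⟩ := (isCompact_closedBall (0 : E) 1).exists_bound_of_continuousOn hc.continuousOn
  have hB0 : 0 ≤ B := (norm_nonneg _).trans (hB 0 (by simp))
  refine ⟨2 * B + α, by positivity, fun x => ?_⟩
  rcases le_or_gt ‖x‖ 1 with h | h
  · have := (abs_le.1 (hB x (by simpa using h))).1
    nlinarith [mul_nonneg hα.le (norm_nonneg x), mul_nonneg hB0 (norm_nonneg x),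
      mul_le_mul_of_nonneg_left (pow_le_one₀ (n := 2) (norm_nonneg x) h) hα.le]
  · have h0 : 0 < ‖x‖ := by linarith
    have hb1 : ‖x‖⁻¹ ≤ 1 := inv_le_one_of_one_le₀ h.le
    have hsc := hV.2 (Set.mem_univ 0) (Set.mem_univ x) (sub_nonneg.2 hb1) (inv_nonneg.2 h0.le)
      (sub_add_cancel _ _)
    have hy := (abs_le.1 (hB (‖x‖⁻¹ • x) (by
      rw [mem_closedBall_zero_iff, norm_smul, norm_inv, norm_norm, inv_mul_cancel₀ h0.ne']))).1
    have hz := (abs_le.1 (hB 0 (by simp))).2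
    simp only [smul_zero, zero_add, smul_eq_mul, zero_sub, norm_neg] at hsc
    have hm := mul_le_mul_of_nonneg_left hsc h0.le
    have e : ‖x‖ * ((1 - ‖x‖⁻¹) * V 0 + ‖x‖⁻¹ * V x
        - (1 - ‖x‖⁻¹) * ‖x‖⁻¹ * (α / 2 * ‖x‖ ^ 2)) =
        (‖x‖ - 1) * V 0 + V x - (‖x‖ - 1) * (α / 2 * ‖x‖) := by
      field_simp
    rw [e] at hm
    nlinarith [mul_le_mul_of_nonneg_left hy h0.le,
      mul_le_mul_of_nonneg_left hz (sub_nonneg.2 h.le)]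

theorem StrongConvexOn.integrable_exp {E : Type*} [NormedAddCommGroup E] [InnerProductSpace ℝ E]
    [FiniteDimensional ℝ E] [MeasurableSpace E] [BorelSpace E] {V : E → ℝ} {α : ℝ}
    (hV : StrongConvexOn Set.univ α V) (hα : 0 < α) (hc : Continuous V) (c : ℝ) :
    Integrable fun x => Real.exp (c * ‖x‖ - V x) := by
  obtain ⟨C, hC, h⟩ := hV.exists_quadratic_le hα hc
  have hG : Integrable fun x : E => Real.exp (-(α / 4) * ‖x‖ ^ 2) := by
    have := (GaussianFourier.integrable_cexp_neg_mul_sq_norm_add (V := E) (b := (α / 4 : ℝ))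
      (by simpa using hα) 0 0).norm
    refine this.congr (.of_forall fun x => ?_)
    simp only [Complex.norm_exp]
    congr 1
    norm_cast
    simp
  refine (hG.const_mul (Real.exp (C + (c + C) ^ 2 / α))).mono' (by fun_prop)
    (.of_forall fun x => ?_)
  rw [Real.norm_of_nonneg (Real.exp_pos _).le, ← Real.exp_add, Real.exp_le_exp]
  have h1 := h x
  have h2 : (c + C) * ‖x‖ ≤ (c + C) ^ 2 / α + α / 4 * ‖x‖ ^ 2 := by
    have : 0 ≤ ((c + C) - α / 2 * ‖x‖) ^ 2 / α := by positivity
    have e : ((c + C) - α / 2 * ‖x‖) ^ 2 / α =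
        (c + C) ^ 2 / α + α / 4 * ‖x‖ ^ 2 - (c + C) * ‖x‖ := by
      field_simp
      ring
    linarith
  linarith

section StrongConvex

variable {d : ℕ} {V : EuclideanSpace ℝ (Fin d) → ℝ} {α : ℝ}

/-- The Prékopa–Leindler inequality for a uniformly log-concave measure. -/
theorem StrongConvexOn.gibbs_prekopa_leindler (hV : StrongConvexOn Set.univ α V)
    (hVm : Measurable V) {a b : ℝ} (ha : 0 < a) (hb : 0 < b) (hab : a + b = 1)
    {p q w : EuclideanSpace ℝ (Fin d) → ℝ} (hp : Measurable p) (hq : Measurable q)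
    (hw : Measurable w) {C : ℝ}
    (h : ∀ x y, a * p x + b * q y ≤ w (a • x + b • y) + a * b * (α / 2 * ‖x - y‖ ^ 2) + C) :
    (∫⁻ x, ENNReal.ofReal (Real.exp (p x)) ∂gibbs V) ^ a
      * (∫⁻ x, ENNReal.ofReal (Real.exp (q x)) ∂gibbs V) ^ b
      ≤ ∫⁻ x, ENNReal.ofReal (Real.exp (w x + C)) ∂gibbs V := by
  rw [lintegral_exp_gibbs hVm hp, lintegral_exp_gibbs hVm hq,
    lintegral_exp_gibbs hVm (by fun_prop)]
  refine EuclideanSpace.prekopa_leindler ha hb hab (by fun_prop) (by fun_prop) (by fun_prop)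
    fun x y => ?_
  rw [ENNReal.ofReal_exp_rpow, ENNReal.ofReal_exp_rpow, ENNReal.ofReal_exp_mul_ofReal_exp,
    ENNReal.ofReal_exp_le_ofReal_exp]
  have := hV.2 (Set.mem_univ x) (Set.mem_univ y) ha.le hb.le hab
  simp only [smul_eq_mul] at this
  linarith [h x y]

theorem mul_le_mul_sq_add_div {α b K r : ℝ} (hα : 0 < α) (hb : 0 < b) :
    K * r ≤ b * (α / 2 * r ^ 2) + K ^ 2 / (2 * b * α) := by
  have : 0 ≤ (K - b * α * r) ^ 2 / (2 * b * α) := by positivity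
  have e : (K - b * α * r) ^ 2 / (2 * b * α) =
      b * (α / 2 * r ^ 2) + K ^ 2 / (2 * b * α) - K * r := by
    field_simp
    ring
  linarith

/-- The relative entropy of a log-Lipschitz perturbation of a uniformly log-concave measure, a form
of the logarithmic Sobolev inequality. -/
theorem StrongConvexOn.integral_gibbs_sub_le (hV : StrongConvexOn Set.univ α V) (hα : 0 < α)
    (hVm : Measurable V) {φ : EuclideanSpace ℝ (Fin d) → ℝ} {M : ℝ}
    (hφ : ∀ x y, |φ x - φ y| ≤ M * ‖x - y‖) [IsProbabilityMeasure (gibbs V)]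
    [IsProbabilityMeasure (gibbs fun x => V x - φ x)]
    (hi : Integrable φ (gibbs fun x => V x - φ x)) :
    ∫ x, φ x ∂(gibbs fun x => V x - φ x) ≤ M ^ 2 / (2 * α) := by
  have hφm : Measurable φ := (continuous_of_abs_sub_le hφ).measurable
  refine le_of_forall_mul_le_of_lt_one (by positivity) fun a ha ha1 => ?_
  have hb : 0 < 1 - a := by linarith
  have hpl := hV.gibbs_prekopa_leindler hVm ha hb (add_sub_cancel _ _)
    (p := fun x => a⁻¹ * φ x) (q := fun _ => 0) (w := φ)
    (C := (1 - a) * (M ^ 2 / (2 * a * α))) (by fun_prop) (by fun_prop) hφm (by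
      intro x y
      have h1 := (abs_le.1 (hφ x (a • x + (1 - a) • y))).2
      have e : x - (a • x + (1 - a) • y) = (1 - a) • (x - y) := by module
      rw [e, norm_smul, Real.norm_of_nonneg hb.le] at h1
      have h2 := mul_le_mul_of_nonneg_left
        (mul_le_mul_sq_add_div (K := M) (r := ‖x - y‖) hα ha) hb.le
      rw [← mul_assoc, mul_inv_cancel₀ ha.ne']
      linarith)
  have hone : ∫⁻ x, ENNReal.ofReal (Real.exp (φ x)) ∂gibbs V = 1 := by
    have := lintegral_exp_gibbs_sub hVm hφm (p := fun _ => 0) measurable_const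
    simpa using this.symm
  have hleft : ENNReal.ofReal (Real.exp ((a⁻¹ - 1) * ∫ x, φ x ∂(gibbs fun x => V x - φ x))) ≤
      ∫⁻ x, ENNReal.ofReal (Real.exp (a⁻¹ * φ x)) ∂gibbs V := by
    rw [← integral_const_mul]
    refine (ofReal_exp_integral_le_lintegral (hi.const_mul _)).trans_eq ?_
    rw [lintegral_exp_gibbs_sub hVm hφm (by fun_prop)]
    refine lintegral_congr fun x => ?_
    congr 2
    ring
  simp only [Real.exp_zero, ENNReal.ofReal_one, lintegral_one, measure_univ, ENNReal.one_rpow,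
    mul_one, Real.exp_add, ENNReal.ofReal_mul (Real.exp_pos _).le] at hpl
  rw [lintegral_mul_const _ (by fun_prop), hone, one_mul] at hpl
  have := (ENNReal.rpow_le_rpow hleft ha.le).trans hpl
  rw [ENNReal.ofReal_exp_rpow, ENNReal.ofReal_exp_le_ofReal_exp] at this
  set I := ∫ x, φ x ∂(gibbs fun x => V x - φ x)
  have e : a * ((a⁻¹ - 1) * I) = (1 - a) * I := by field_simp
  rw [e] at this
  have h3 := le_of_mul_le_mul_left this hb
  calc a * I ≤ a * (M ^ 2 / (2 * a * α)) := by gcongr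
    _ = M ^ 2 / (2 * α) := by field_simp

/-- Gaussian concentration of Lipschitz functions under a uniformly log-concave measure. -/
theorem StrongConvexOn.lintegral_exp_gibbs_le (hV : StrongConvexOn Set.univ α V) (hα : 0 < α)
    (hVm : Measurable V) {g : EuclideanSpace ℝ (Fin d) → ℝ} {K : ℝ}
    (hg : ∀ x y, |g x - g y| ≤ K * ‖x - y‖) [IsProbabilityMeasure (gibbs V)]
    (hi : Integrable g (gibbs V)) :
    ∫⁻ x, ENNReal.ofReal (Real.exp (g x)) ∂gibbs V
      ≤ ENNReal.ofReal (Real.exp ((∫ x, g x ∂gibbs V) + K ^ 2 / (2 * α))) := by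
  have hgm : Measurable g := (continuous_of_abs_sub_le hg).measurable
  set I := ∫ x, g x ∂gibbs V
  set J := ∫⁻ x, ENNReal.ofReal (Real.exp (g x)) ∂gibbs V with hJ
  have key : ∀ b : ℝ, 0 < b → b < 1 →
      J ≤ ENNReal.ofReal (Real.exp (K ^ 2 / (2 * b * α) + I)) := by
    intro b hb hb1
    have ha : 0 < 1 - b := by linarith
    have hpl := hV.gibbs_prekopa_leindler hVm ha hb (sub_add_cancel _ _)
      (p := g) (q := fun x => -((1 - b) / b) * g x) (w := fun _ => 0)
      (C := (1 - b) * (K ^ 2 / (2 * b * α))) hgm (by fun_prop) (by fun_prop) (by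
        intro x y
        have h1 := mul_le_mul_of_nonneg_left (((abs_le.1 (hg x y)).2).trans
          (mul_le_mul_sq_add_div (K := K) (r := ‖x - y‖) hα hb)) ha.le
        have e : b * (-((1 - b) / b) * g y) = -(1 - b) * g y := by field_simp
        rw [e]
        linarith)
    have hright : ENNReal.ofReal (Real.exp (-((1 - b) / b) * I)) ≤
        ∫⁻ x, ENNReal.ofReal (Real.exp (-((1 - b) / b) * g x)) ∂gibbs V := by
      rw [← integral_const_mul]
      exact ofReal_exp_integral_le_lintegral (hi.const_mul _)
    have h2 := (mul_le_mul_right (ENNReal.rpow_le_rpow hright hb.le) (J ^ (1 - b))).trans hpl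
    simp only [zero_add, lintegral_const, measure_univ, mul_one] at h2
    rw [ENNReal.ofReal_exp_rpow] at h2
    have e : b * (-((1 - b) / b) * I) = -((1 - b) * I) := by field_simp
    rw [e] at h2
    have h3 := mul_le_mul_left h2 (ENNReal.ofReal (Real.exp ((1 - b) * I)))
    rw [mul_assoc, ENNReal.ofReal_exp_mul_ofReal_exp, ENNReal.ofReal_exp_mul_ofReal_exp,
      neg_add_cancel, Real.exp_zero, ENNReal.ofReal_one, mul_one, ← mul_add,
      ← ENNReal.ofReal_exp_rpow] at h3
    exact (ENNReal.rpow_le_rpow_iff ha).1 h3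
  have hJtop : J ≠ ∞ := ne_top_of_le_ne_top ENNReal.ofReal_ne_top
    (key (1 / 2) (by norm_num) (by norm_num))
  have hJ0 : J ≠ 0 := fun h0 => by
    have := ofReal_exp_integral_le_lintegral hi
    rw [← hJ, h0] at this
    simp [(Real.exp_pos _).not_ge] at this
  have hJl : J = ENNReal.ofReal (Real.exp (Real.log J.toReal)) := by
    rw [Real.exp_log (ENNReal.toReal_pos hJ0 hJtop), ENNReal.ofReal_toReal hJtop]
  rw [hJl, ENNReal.ofReal_exp_le_ofReal_exp]
  have : Real.log J.toReal - I ≤ K ^ 2 / (2 * α) := by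
    refine le_of_forall_mul_le_of_lt_one (by positivity) fun b hb hb1 => ?_
    have h1 := key b hb hb1
    rw [hJl, ENNReal.ofReal_exp_le_ofReal_exp] at h1
    calc b * (Real.log J.toReal - I) ≤ b * (K ^ 2 / (2 * b * α)) := by
          gcongr
          linarith
      _ = K ^ 2 / (2 * α) := by field_simp
  linarith

theorem lintegral_exp_mul_gaussianReal (t : ℝ) :
    ∫⁻ y, ENNReal.ofReal (Real.exp (t * y)) ∂(ProbabilityTheory.gaussianReal 0 1) =
      ENNReal.ofReal (Real.exp (t ^ 2 / 2)) := by
  rw [← ofReal_integral_eq_lintegral_ofReal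
    (ProbabilityTheory.integrable_exp_mul_gaussianReal t) (.of_forall fun x => (Real.exp_pos _).le)]
  have := ProbabilityTheory.mgf_gaussianReal (p := ProbabilityTheory.gaussianReal 0 1) (X := id)
    (μ := 0) (v := 1) Measure.map_id t
  rw [ProbabilityTheory.mgf] at this
  simp only [id] at this
  rw [this]
  simp

theorem lintegral_exp_sq_div_four_gaussianReal :
    ∫⁻ y, ENNReal.ofReal (Real.exp (y ^ 2 / 4)) ∂(ProbabilityTheory.gaussianReal 0 1) =
      ENNReal.ofReal (√2) := by
  rw [ProbabilityTheory.gaussianReal_of_var_ne_zero _ one_ne_zero,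
    lintegral_withDensity_eq_lintegral_mul _ (ProbabilityTheory.measurable_gaussianPDF _ _)
      (by fun_prop)]
  have e : ∀ y : ℝ, (ProbabilityTheory.gaussianPDF 0 1 *
      fun y => ENNReal.ofReal (Real.exp (y ^ 2 / 4))) y =
      ENNReal.ofReal ((√(2 * π))⁻¹ * Real.exp (-(1 / 4) * y ^ 2)) := by
    intro y
    rw [Pi.mul_apply, ProbabilityTheory.gaussianPDF_def, ProbabilityTheory.gaussianPDFReal_def,
      ← ENNReal.ofReal_mul (by positivity), mul_assoc, ← Real.exp_add]
    congr 3
    · simp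
    · simp
      ring
  simp_rw [e]
  rw [← ofReal_integral_eq_lintegral_ofReal
    ((integrable_exp_neg_mul_sq (by norm_num)).const_mul _) (.of_forall fun x => by positivity),
    integral_const_mul, integral_gaussian]
  congr 1
  rw [← Real.sqrt_inv, ← Real.sqrt_mul (by positivity)]
  congr 1
  field_simp
  norm_num

/-- Square-exponential integrability of Lipschitz functions under a uniformly log-concave
measure. -/
theorem StrongConvexOn.lintegral_exp_sq_gibbs_le (hV : StrongConvexOn Set.univ α V) (hα : 0 < α)
    (hVm : Measurable V) {g : EuclideanSpace ℝ (Fin d) → ℝ} {K : ℝ}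
    (hg : ∀ x y, |g x - g y| ≤ K * ‖x - y‖) [IsProbabilityMeasure (gibbs V)]
    (hi : Integrable g (gibbs V)) (hint : ∫ x, g x ∂gibbs V = 0) {θ : ℝ} (hθ : 0 ≤ θ)
    (hθK : 4 * θ * K ^ 2 ≤ α) :
    ∫⁻ x, ENNReal.ofReal (Real.exp (θ * g x ^ 2)) ∂gibbs V ≤ ENNReal.ofReal (√2) := by
  have hgm : Measurable g := (continuous_of_abs_sub_le hg).measurable
  have hs : √(2 * θ) ^ 2 = 2 * θ := Real.sq_sqrt (by positivity)
  calc ∫⁻ x, ENNReal.ofReal (Real.exp (θ * g x ^ 2)) ∂gibbs V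
      = ∫⁻ x, ∫⁻ y, ENNReal.ofReal (Real.exp (√(2 * θ) * g x * y))
          ∂(ProbabilityTheory.gaussianReal 0 1) ∂gibbs V := by
        refine lintegral_congr fun x => ?_
        rw [lintegral_exp_mul_gaussianReal, mul_pow, hs]
        congr 2
        ring
    _ = ∫⁻ y, ∫⁻ x, ENNReal.ofReal (Real.exp (√(2 * θ) * g x * y)) ∂gibbs V
          ∂(ProbabilityTheory.gaussianReal 0 1) :=
        lintegral_lintegral_swap (by fun_prop)
    _ ≤ ∫⁻ y, ENNReal.ofReal (Real.exp (y ^ 2 / 4)) ∂(ProbabilityTheory.gaussianReal 0 1) := by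
        refine lintegral_mono fun y => ?_
        have h1 := hV.lintegral_exp_gibbs_le hα hVm (g := fun x => √(2 * θ) * y * g x)
          (K := |√(2 * θ) * y| * K) (fun x z => by
            rw [← mul_sub, abs_mul, mul_assoc]
            exact mul_le_mul_of_nonneg_left (hg x z) (abs_nonneg _)) (hi.const_mul _)
        rw [integral_const_mul, hint, mul_zero, zero_add, mul_pow, sq_abs, mul_pow, hs] at h1
        refine le_trans (le_of_eq (lintegral_congr fun x => ?_)) (h1.trans ?_)
        · congr 2
          ring
        · rw [ENNReal.ofReal_exp_le_ofReal_exp, div_le_div_iff₀ (by positivity) (by positivity)]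
          nlinarith [mul_le_mul_of_nonneg_left hθK (sq_nonneg y)]
    _ = ENNReal.ofReal (√2) := lintegral_exp_sq_div_four_gaussianReal

/-- Variance bound for Lipschitz functions under a log-Lipschitz perturbation of a uniformly
log-concave measure. -/
theorem StrongConvexOn.variance_gibbs_sub_le (hV : StrongConvexOn Set.univ α V) (hα : 0 < α)
    (hVc : Continuous V) {φ g : EuclideanSpace ℝ (Fin d) → ℝ} {M K : ℝ} (hM : 0 ≤ M) (hK : 0 < K)
    (hφ : ∀ x y, |φ x - φ y| ≤ M * ‖x - y‖) (hg : ∀ x y, |g x - g y| ≤ K * ‖x - y‖)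
    [IsProbabilityMeasure (gibbs V)] [IsProbabilityMeasure (gibbs fun x => V x - φ x)] :
    (∫ x, g x ^ 2 ∂(gibbs fun x => V x - φ x)) - (∫ x, g x ∂(gibbs fun x => V x - φ x)) ^ 2
      ≤ 2 * K ^ 2 * (α⁻¹ + (M / α) ^ 2) := by
  have hφc := continuous_of_abs_sub_le hφ
  have hgc := continuous_of_abs_sub_le hg
  set ρ := gibbs fun x => V x - φ x with hρ
  have hiV : ∀ c : ℝ, Integrable fun x => Real.exp (c * ‖x‖ - V x) := hV.integrable_exp hα hVc
  have hiU : ∀ c : ℝ, Integrable fun x => Real.exp (c * ‖x‖ - (V x - φ x)) := by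
    intro c
    refine ((hiV (c + M)).const_mul (Real.exp (φ 0))).mono' (by fun_prop) (.of_forall fun x => ?_)
    rw [Real.norm_of_nonneg (Real.exp_pos _).le, ← Real.exp_add, Real.exp_le_exp]
    have : φ x - φ 0 ≤ M * ‖x‖ := by simpa using (abs_le.1 (hφ x 0)).2
    linarith
  have hφρ : Integrable φ ρ := integrable_gibbs_of_abs_le (by fun_prop) hφc (hiU 1)
    (by simpa using abs_le_mul_exp_norm hM hφ)
  have hgρ : Integrable g ρ := integrable_gibbs_of_abs_le (by fun_prop) hgc (hiU 1)
    (by simpa using abs_le_mul_exp_norm hK.le hg)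
  have hg2ρ : Integrable (fun x => g x ^ 2) ρ :=
    integrable_gibbs_of_abs_le (C := (|g 0| + K) ^ 2) (by fun_prop) (by fun_prop) (hiU 2)
      (fun x => by
        rw [abs_pow, two_mul, Real.exp_add, ← sq, ← mul_pow]
        gcongr
        exact abs_le_mul_exp_norm hK.le hg x)
  have hgV : Integrable g (gibbs V) := integrable_gibbs_of_abs_le hVc hgc (hiV 1)
    (by simpa using abs_le_mul_exp_norm hK.le hg)
  set c := ∫ x, g x ∂gibbs V with hc
  have hvar : ∫ x, (g x - c) ^ 2 ∂ρ = (∫ x, g x ^ 2 ∂ρ) - 2 * c * (∫ x, g x ∂ρ) + c ^ 2 := by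
    have e : ∀ x, (g x - c) ^ 2 = g x ^ 2 - 2 * c * g x + c ^ 2 := fun x => by ring
    simp_rw [e]
    have hd : Integrable (fun x => g x ^ 2 - 2 * c * g x) ρ := hg2ρ.sub (hgρ.const_mul _)
    rw [integral_add hd (integrable_const _), integral_sub hg2ρ (hgρ.const_mul _), integral_const_mul, integral_const]
    simp
  have hsqρ : Integrable (fun x => (g x - c) ^ 2) ρ := by
    have : Integrable (fun x => g x ^ 2 - 2 * c * g x + c ^ 2) ρ :=
      (hg2ρ.sub (hgρ.const_mul _)).add (integrable_const _)
    exact this.congr (.of_forall fun x => by ring)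
  have hent := hV.integral_gibbs_sub_le hα hVc.measurable hφ hφρ
  have hexp := hV.lintegral_exp_sq_gibbs_le hα hVc.measurable (g := fun x => g x - c) (K := K)
    (θ := α / (4 * K ^ 2)) (fun x y => by simpa using hg x y) (hgV.sub (integrable_const c))
    (by rw [integral_sub hgV (integrable_const c)]; simp [hc]) (by positivity)
    (le_of_eq (by field_simp))
  set θ := α / (4 * K ^ 2) with hθ
  have hjen := (ofReal_exp_integral_le_lintegral (μ := ρ) ((hsqρ.const_mul θ).sub hφρ)).trans_eq
    (lintegral_exp_gibbs_sub hVc.measurable hφc.measurable (by fun_prop))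
  simp only [Pi.sub_apply, sub_add_cancel] at hjen
  have hle := hjen.trans hexp
  rw [integral_sub (hsqρ.const_mul θ) hφρ, integral_const_mul,
    ← Real.exp_log (show 0 < √2 by positivity), ENNReal.ofReal_exp_le_ofReal_exp,
    Real.log_sqrt (by norm_num)] at hle
  have hlog : Real.log 2 ≤ 1 := by linarith [Real.log_two_lt_d9]
  have hsq : θ * ∫ x, (g x - c) ^ 2 ∂ρ ≤ 1 / 2 + M ^ 2 / (2 * α) := by linarith
  have hfin : ∫ x, (g x - c) ^ 2 ∂ρ ≤ 2 * K ^ 2 * (α⁻¹ + (M / α) ^ 2) := by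
    have hθ0 : 0 < θ := by positivity
    refine le_of_mul_le_mul_left (hsq.trans_eq ?_) hθ0
    rw [hθ]
    field_simp
    ring
  nlinarith [sq_nonneg ((∫ x, g x ∂ρ) - c)]

end StrongConvex

open scoped Topology in
/-- A continuous function that is, along each line, locally supported from below up to a quadratic
error with arbitrarily small constant is convex. -/
theorem convexOn_univ_of_eventually_ge {E : Type*} [NormedAddCommGroup E] [NormedSpace ℝ E]
    {W : E → ℝ} (hW : Continuous W)
    (h : ∀ x w : E, ∃ p : ℝ, ∀ ε > 0, ∀ᶠ s : ℝ in 𝓝 0,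
      W x + p * s - ε * s ^ 2 ≤ W (x + s • w)) :
    ConvexOn ℝ Set.univ W := by
  refine ⟨convex_univ, fun x _ y _ a b ha hb hab => ?_⟩
  by_contra! hlt
  obtain rfl : a = 1 - b := by linarith
  have hpt : (1 - b) • x + b • y = x + b • (y - x) := by module
  rw [hpt, smul_eq_mul, smul_eq_mul] at hlt
  set gap := W (x + b • (y - x)) - ((1 - b) * W x + b * W y) with hgap
  have hgap0 : 0 < gap := sub_pos.2 hlt
  let ψ : ℝ → ℝ := fun s => W (x + s • (y - x)) - ((1 - s) * W x + s * W y) + gap * (s ^ 2 - s)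
  have hψ : Continuous ψ := by fun_prop
  obtain ⟨s₀, hs₀, hmax⟩ := isCompact_Icc.exists_isMaxOn (Set.nonempty_Icc.2 zero_le_one)
    (hψ.continuousOn (s := Set.Icc (0 : ℝ) 1))
  have hψb : 0 < ψ b := by
    have : ψ b = gap * (1 - b + b ^ 2) := by simp only [ψ, hgap]; ring
    rw [this]
    have : 0 < 1 - b + b ^ 2 := by nlinarith
    positivity
  have hψs : 0 < ψ s₀ := hψb.trans_le (hmax ⟨hb, by linarith⟩)
  have h0 : s₀ ≠ 0 := by
    rintro rfl
    simp [ψ] at hψs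
  have h1 : s₀ ≠ 1 := by
    rintro rfl
    simp [ψ] at hψs
  have hs0 : 0 < s₀ := lt_of_le_of_ne hs₀.1 h0.symm
  have hs1 : s₀ < 1 := lt_of_le_of_ne hs₀.2 h1
  obtain ⟨p, hp⟩ := h (x + s₀ • (y - x)) (y - x)
  have hev := hp (gap / 2) (by positivity)
  have hnear : ∀ᶠ s : ℝ in 𝓝 0, s₀ + s ∈ Set.Icc (0 : ℝ) 1 := by
    have : Filter.Tendsto (fun s : ℝ => s₀ + s) (𝓝 0) (𝓝 s₀) := by
      have : Continuous fun s : ℝ => s₀ + s := by fun_prop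
      simpa using this.tendsto 0
    exact this.eventually (Icc_mem_nhds hs0 hs1)
  obtain ⟨δ, hδ, hball⟩ := Metric.eventually_nhds_iff.1 (hev.and hnear)
  have hstep : ∀ s : ℝ, |s| < δ →
      (p - (W y - W x) + gap * (2 * s₀ - 1)) * s + gap / 2 * s ^ 2 ≤ 0 := by
    intro s hs
    obtain ⟨hs1, hs2⟩ := hball (y := s) (by simpa using hs)
    have hle : ψ (s₀ + s) ≤ ψ s₀ := hmax hs2
    have e : x + s₀ • (y - x) + s • (y - x) = x + (s₀ + s) • (y - x) := by module
    rw [e] at hs1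
    simp only [ψ] at hle
    linarith
  have hp1 := hstep (δ / 2) (by rw [abs_of_pos (by positivity)]; linarith)
  have hp2 := hstep (-(δ / 2)) (by rw [abs_neg, abs_of_pos (by positivity)]; linarith)
  have : 0 < gap / 2 * (δ / 2) ^ 2 := by positivity
  nlinarith

section Huber

variable {E : Type*} [NormedAddCommGroup E] [InnerProductSpace ℝ E]

/-- The Huber function of radius `R`: quadratic on the ball, affine in the norm outside. -/
def huber (R : ℝ) (x : E) : ℝ := if ‖x‖ < R then ‖x‖ ^ 2 / 2 else R * ‖x‖ - R ^ 2 / 2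

theorem inner_sub_le_huber {R : ℝ} {q : E} (hq : ‖q‖ ≤ R) (x : E) :
    ⟪q, x⟫ - ‖q‖ ^ 2 / 2 ≤ huber R x := by
  have h1 : ⟪q, x⟫ ≤ ‖q‖ * ‖x‖ := real_inner_le_norm q x
  have h2 := norm_nonneg q
  unfold huber
  split_ifs with h
  · nlinarith [sq_nonneg (‖x‖ - ‖q‖)]
  · push Not at h
    nlinarith

theorem exists_huber_eq {R : ℝ} (hR : 0 ≤ R) (x : E) :
    ∃ q : E, ‖q‖ ≤ R ∧ huber R x = ⟪q, x⟫ - ‖q‖ ^ 2 / 2 := by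
  by_cases h : ‖x‖ < R
  · refine ⟨x, h.le, ?_⟩
    rw [huber, if_pos h, real_inner_self_eq_norm_sq]
    ring
  · have hx : R ≤ ‖x‖ := not_lt.1 h
    rcases (norm_nonneg x).eq_or_lt with h0 | h0
    · have hR0 : R = 0 := by linarith
      exact ⟨0, by simpa using hR, by simp [huber, hR0]⟩
    · have hn : ‖(R / ‖x‖) • x‖ = R := by
        rw [norm_smul, Real.norm_of_nonneg (by positivity), div_mul_cancel₀ _ h0.ne']
      refine ⟨(R / ‖x‖) • x, hn.le, ?_⟩
      rw [huber, if_neg h, hn, real_inner_smul_left, real_inner_self_eq_norm_sq]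
      field_simp

theorem exists_inner_le_huber_sub {R : ℝ} (hR : 0 ≤ R) (x : E) :
    ∃ q : E, ‖q‖ ≤ R ∧ ∀ y, ⟪q, y - x⟫ ≤ huber R y - huber R x := by
  obtain ⟨q, hq, hx⟩ := exists_huber_eq hR x
  refine ⟨q, hq, fun y => ?_⟩
  have := inner_sub_le_huber hq y
  rw [inner_sub_right]
  linarith

theorem abs_huber_sub_le {R : ℝ} (hR : 0 ≤ R) (x y : E) :
    |huber R x - huber R y| ≤ R * ‖x - y‖ := by
  have key : ∀ x y : E, huber R x - huber R y ≤ R * ‖x - y‖ := by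
    intro x y
    obtain ⟨q, hq, h⟩ := exists_inner_le_huber_sub hR x
    have h1 := h y
    have h2 : ⟪q, x - y⟫ ≤ ‖q‖ * ‖x - y‖ := real_inner_le_norm _ _
    have h3 : ⟪q, y - x⟫ = -⟪q, x - y⟫ := by rw [← inner_neg_right, neg_sub]
    nlinarith [norm_nonneg (x - y)]
  refine abs_le.2 ⟨?_, key x y⟩
  have := key y x
  rw [norm_sub_rev] at this
  linarith

theorem huber_nonneg {R : ℝ} (hR : 0 ≤ R) (x : E) : 0 ≤ huber R x := by
  simpa using inner_sub_le_huber (q := (0 : E)) (by simpa using hR) x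

theorem continuous_huber {R : ℝ} (hR : 0 ≤ R) : Continuous (huber R : E → ℝ) := by
  refine LipschitzWith.continuous (K := ⟨R, hR⟩) (LipschitzWith.of_dist_le_mul fun x y => ?_)
  rw [Real.dist_eq, dist_eq_norm]
  exact abs_huber_sub_le hR x y

end Huber

open scoped Topology in
/-- The second-order Taylor expansion along a line, as a lower bound. -/
theorem ContDiff.eventually_le_add_smul {E : Type*} [NormedAddCommGroup E] [InnerProductSpace ℝ E]
    [CompleteSpace E] {U : E → ℝ} (hU : ContDiff ℝ 2 U) (x w : E) {ε : ℝ} (hε : 0 < ε) :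
    ∀ᶠ s : ℝ in 𝓝 0, U x + ⟪gradient U x, w⟫ * s
      + ⟪fderiv ℝ (gradient U) x w, w⟫ / 2 * s ^ 2 - ε * s ^ 2 ≤ U (x + s • w) := by
  have hU1 : Differentiable ℝ U := hU.differentiable (by norm_num)
  have hG : Differentiable ℝ (gradient U) := by
    have : ContDiff ℝ 1 (fderiv ℝ U) := hU.fderiv_right (by norm_num)
    exact ((InnerProductSpace.toDual ℝ E).symm.differentiable).comp
      (this.differentiable (by norm_num))
  let u : ℝ → ℝ := fun s => U (x + s • w)
  have hline : ∀ s : ℝ, HasDerivAt (fun s : ℝ => x + s • w) w s := fun s => by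
    simpa using ((hasDerivAt_id s).smul_const w).const_add x
  have hu : ContDiff ℝ 2 u := hU.comp (by fun_prop)
  have hd1 : ∀ s, HasDerivAt u ⟪gradient U (x + s • w), w⟫ s := by
    intro s
    have h := (hU1 (x + s • w)).hasFDerivAt.comp_hasDerivAt s (hline s)
    have e : ⟪gradient U (x + s • w), w⟫ = fderiv ℝ U (x + s • w) w := by simp
    rw [e]
    exact h
  have hd2 : HasDerivAt (fun s : ℝ => ⟪gradient U (x + s • w), w⟫)
      ⟪fderiv ℝ (gradient U) x w, w⟫ 0 := by
    have h0 : HasFDerivAt (gradient U) (fderiv ℝ (gradient U) x) (x + (0 : ℝ) • w) := by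
      simpa using (hG x).hasFDerivAt
    simpa using (h0.comp_hasDerivAt (0 : ℝ) (hline 0)).inner ℝ (hasDerivAt_const (0 : ℝ) w)
  have e1 : deriv u = fun s : ℝ => ⟪gradient U (x + s • w), w⟫ := funext fun s => (hd1 s).deriv
  have e2 : iteratedDeriv 2 u 0 = ⟪fderiv ℝ (gradient U) x w, w⟫ := by
    rw [iteratedDeriv_succ, iteratedDeriv_one, e1, hd2.deriv]
  have ht := (taylor_isLittleO_univ (x₀ := 0) (n := 2) hu).def hε
  filter_upwards [ht] with s hs
  have e3 : deriv u 0 = ⟪gradient U x, w⟫ := by simp [e1]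
  simp only [taylorWithinEval_succ, taylor_within_zero_eval, iteratedDerivWithin_univ, e2] at hs
  norm_num [e3] at hs
  simp only [u, zero_smul, add_zero] at hs
  have e4 : ⟪gradient U x, w⟫ = fderiv ℝ U x w := by simp
  have := neg_le_of_abs_le hs
  rw [e4]
  linarith

open scoped Topology in
/-- Adding a multiple of the Huber function to a potential that is convex outside a ball makes it
uniformly convex. -/
theorem strongConvexOn_add_huber {E : Type*} [NormedAddCommGroup E] [InnerProductSpace ℝ E]
    [CompleteSpace E] {U : E → ℝ} (hU : ContDiff ℝ 2 U) {α L R : ℝ} (hα : 0 < α) (hL : 0 ≤ L)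
    (hR : 0 ≤ R)
    (hin : ∀ x v : E, ‖x‖ < R → -L * ‖v‖ ^ 2 ≤ ⟪fderiv ℝ (gradient U) x v, v⟫)
    (hout : ∀ x v : E, R ≤ ‖x‖ → α * ‖v‖ ^ 2 ≤ ⟪fderiv ℝ (gradient U) x v, v⟫) :
    StrongConvexOn Set.univ α fun x => U x + (L + α) * huber R x := by
  rw [strongConvexOn_iff_convex]
  have hcU := hU.continuous
  have hch := continuous_huber (E := E) hR
  refine convexOn_univ_of_eventually_ge (by fun_prop) fun x w => ?_
  have hnorm : ∀ s : ℝ, ‖x + s • w‖ ^ 2 = ‖x‖ ^ 2 + 2 * ⟪x, w⟫ * s + ‖w‖ ^ 2 * s ^ 2 := by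
    intro s
    rw [norm_add_sq_real, real_inner_smul_right, norm_smul, mul_pow, Real.norm_eq_abs, sq_abs]
    ring
  by_cases hx : ‖x‖ < R
  · refine ⟨⟪gradient U x, w⟫ + (L + α) * ⟪x, w⟫ - α * ⟪x, w⟫, fun ε hε => ?_⟩
    have hnear : ∀ᶠ s : ℝ in 𝓝 0, ‖x + s • w‖ < R := by
      have : Continuous fun s : ℝ => ‖x + s • w‖ := by fun_prop
      exact this.continuousAt.eventually_lt continuousAt_const (by simpa using hx)
    filter_upwards [hU.eventually_le_add_smul x w hε, hnear] with s hs hsR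
    rw [huber, huber, if_pos hx, if_pos hsR, hnorm]
    nlinarith [mul_le_mul_of_nonneg_right (hin x w hx) (sq_nonneg s)]
  · obtain ⟨q, -, hq⟩ := exists_inner_le_huber_sub hR x
    refine ⟨⟪gradient U x, w⟫ + (L + α) * ⟪q, w⟫ - α * ⟪x, w⟫, fun ε hε => ?_⟩
    filter_upwards [hU.eventually_le_add_smul x w hε] with s hs
    have h1 := hq (x + s • w)
    rw [add_sub_cancel_left, real_inner_smul_right] at h1
    have h2 := mul_le_mul_of_nonneg_left h1 (by positivity : 0 ≤ L + α)
    rw [hnorm]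
    nlinarith [mul_le_mul_of_nonneg_right (hout x w (not_lt.1 hx)) (sq_nonneg s)]

/-- Lemma 2.3: a variance bound for Lipschitz functions under measures whose potential is
convex outside a ball. -/
theorem variance_bound_convex_outside_ball {d : ℕ}
    (U : EuclideanSpace ℝ (Fin d) → ℝ) (hU : ContDiff ℝ 2 U)
    (hU_norm : ∫ x : EuclideanSpace ℝ (Fin d), Real.exp (-U x) = 1)
    (α L R ℓ : ℝ) (hα : 0 < α) (hL : 0 ≤ L) (hR : 0 ≤ R) (hℓ : 0 ≤ ℓ)
    (hhess_in : ∀ (x v : EuclideanSpace ℝ (Fin d)), ‖x‖ < R → -L * ‖v‖ ^ 2 ≤ ⟪fderiv ℝ (gradient U) x v, v⟫)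
    (hhess_out : ∀ (x v : EuclideanSpace ℝ (Fin d)), R ≤ ‖x‖ → α * ‖v‖ ^ 2 ≤ ⟪fderiv ℝ (gradient U) x v, v⟫)
    (f : EuclideanSpace ℝ (Fin d) → EuclideanSpace ℝ (Fin d))
    (hf : ∀ x x', ‖f x - f x'‖ ≤ ℓ * ‖x - x'‖) :
    ∀ v : EuclideanSpace ℝ (Fin d), ‖v‖ = 1 →
      (∫ x, ⟪f x, v⟫ ^ 2 ∂(volume.withDensity fun x => ENNReal.ofReal (Real.exp (-U x))))
        - (∫ x, ⟪f x, v⟫ ∂(volume.withDensity fun x => ENNReal.ofReal (Real.exp (-U x)))) ^ 2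
      ≤ 2 * ℓ ^ 2 * (α⁻¹ + (α⁻¹) ^ 2 * (L + α) ^ 2 * R ^ 2) := by
  intro v hv
  rw [← gibbs]
  have hprob : IsProbabilityMeasure (gibbs U) := isProbabilityMeasure_gibbs hU_norm
  have hg : ∀ x y, |⟪f x, v⟫ - ⟪f y, v⟫| ≤ ℓ * ‖x - y‖ := fun x y => by
    rw [← inner_sub_left]
    refine (abs_real_inner_le_norm _ _).trans ?_
    rw [hv, mul_one]
    exact hf x y
  rcases hℓ.eq_or_lt with rfl | hℓ0
  · have hconst : ∀ x, ⟪f x, v⟫ = ⟪f 0, v⟫ := fun x => by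
      have := hg x 0
      rw [zero_mul] at this
      exact sub_eq_zero.1 (abs_nonpos_iff.1 this)
    simp [hconst]
  have hsc := strongConvexOn_add_huber hU hα hL hR hhess_in hhess_out
  have hUc := hU.continuous
  have hhc := continuous_huber (E := EuclideanSpace ℝ (Fin d)) hR
  set W : EuclideanSpace ℝ (Fin d) → ℝ := fun x => U x + (L + α) * huber R x with hW
  have hWc : Continuous W := by fun_prop
  have hWi : Integrable fun x => Real.exp (-W x) := by simpa using hsc.integrable_exp hα hWc 0
  set κ := Real.log (∫ x, Real.exp (-W x)) with hκ
  have hZ : 0 < ∫ x, Real.exp (-W x) := integral_exp_pos hWi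
  set V : EuclideanSpace ℝ (Fin d) → ℝ := fun x => W x + κ with hV
  have hVsc : StrongConvexOn Set.univ α V := by
    refine ⟨convex_univ, fun x hx y hy a b ha hb hab => ?_⟩
    have := hsc.2 hx hy ha hb hab
    simp only [hV, smul_eq_mul] at this ⊢
    have e : κ = a * κ + b * κ := by rw [← add_mul, hab, one_mul]
    linarith
  have hVprob : IsProbabilityMeasure (gibbs V) := by
    refine isProbabilityMeasure_gibbs ?_
    simp only [hV, neg_add, Real.exp_add]
    rw [integral_mul_const, Real.exp_neg κ, hκ, Real.exp_log hZ, mul_inv_cancel₀ hZ.ne']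
  have hUV : U = fun x => V x - ((L + α) * huber R x + κ) := by
    ext x
    simp only [hV, hW]
    ring
  rw [hUV] at hprob ⊢
  have := hVsc.variance_gibbs_sub_le hα (by fun_prop) (φ := fun x => (L + α) * huber R x + κ)
    (M := (L + α) * R) (by positivity) hℓ0 (fun x y => by
      rw [add_sub_add_right_eq_sub, ← mul_sub, abs_mul, abs_of_nonneg (by positivity), mul_assoc]
      exact mul_le_mul_of_nonneg_left (abs_huber_sub_le hR x y) (by positivity)) hg
  refine this.trans_eq ?_
  rw [div_eq_mul_inv]
  ring
end
end
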